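/- arXiv:1209.4122 — 4 statements merged into one kernel-verified Lean document; each statement's English description precedes it below -/
import Mathlib

section
/- Let n ≥ 1 and let q_1, …, q_r be positive integers with q_1 + ⋯ + q_r = n. Let ν be an n×n real matrix which is diagonalizable over ℝ with exactly r distinct eigenvalues whose multiplicities are q_1, …, q_r. Let (X, H, Y) be an sl₂-triple of n×n real matrices such that for every integer k with 0 ≤ k ≤ n, the ℝ-dimension of the kernel of X^k equals the sum of the k largest values among q_1, …, q_r (counted with repetition; in particular this sum is n for k ≥ r). Then the set O_ν ∩ (X + Z(Y)) = {g ν g⁻¹ : g ∈ GL(n,ℝ)} ∩ {X + C : C Y = Y C} contains exactly one element. -/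
namespace Slice

structure Sl2 {E : Type*} [AddCommGroup E] [Module ℝ E] (x h y : Module.End ℝ E) : Prop where
  hx : h * x = x * h + (2 : ℝ) • x
  hy : h * y = y * h - (2 : ℝ) • y
  xy : x * y = y * x + h

section Rep
variable {E : Type*} [AddCommGroup E] [Module ℝ E]

/-- joint eigenspaces -/
def V (x h y : Module.End ℝ E) (k l : ℕ) : Submodule ℝ E where
  carrier := {v | h v = ((k : ℝ) - l) • v ∧ x (y v) = ((k : ℝ) * (l + 1)) • v}
  add_mem' := by
    rintro a b ⟨h1, h2⟩ ⟨h3, h4⟩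
    exact ⟨by rw [map_add, h1, h3, smul_add], by rw [map_add, map_add, h2, h4, smul_add]⟩
  zero_mem' := by simp
  smul_mem' := by
    rintro c a ⟨h1, h2⟩
    exact ⟨by rw [map_smul, h1, smul_comm], by rw [map_smul, map_smul, h2, smul_comm]⟩

variable {x h y : Module.End ℝ E}

lemma mem_V {k l : ℕ} {v : E} : v ∈ V x h y k l ↔
    h v = ((k : ℝ) - l) • v ∧ x (y v) = ((k : ℝ) * (l + 1)) • v := Iff.rfl

lemma Sl2.hx' (S : Sl2 x h y) (v : E) : h (x v) = x (h v) + (2 : ℝ) • x v := by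
  have := congrArg (fun f => f v) S.hx; simpa using this
lemma Sl2.hy' (S : Sl2 x h y) (v : E) : h (y v) = y (h v) - (2 : ℝ) • y v := by
  have := congrArg (fun f => f v) S.hy; simpa using this
lemma Sl2.xy' (S : Sl2 x h y) (v : E) : x (y v) = y (x v) + h v := by
  have := congrArg (fun f => f v) S.xy; simpa using this

lemma Sl2.symm (S : Sl2 x h y) : Sl2 y (-h) x where
  hx := by rw [neg_mul, S.hy]; simp [sub_eq_add_neg, add_comm]
  hy := by rw [neg_mul, S.hx]; simp [sub_eq_add_neg, add_comm]
  xy := by rw [S.xy]; simp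

lemma V_symm (S : Sl2 x h y) (k l : ℕ) : V x h y k l = V y (-h) x l k := by
  ext v
  rw [mem_V, mem_V]
  have h3 := S.xy' v
  constructor
  · rintro ⟨h1, h2⟩
    refine ⟨by rw [LinearMap.neg_apply, h1]; module, ?_⟩
    have : y (x v) = x (y v) - h v := by rw [h3]; abel
    rw [this, h2, h1]; module
  · rintro ⟨h1, h2⟩
    have h1' : h v = ((k : ℝ) - l) • v := by
      rw [LinearMap.neg_apply] at h1
      rw [← neg_neg (h v), h1]; module
    refine ⟨h1', ?_⟩
    rw [h3, h2, h1']; module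

lemma Sl2.yxpow (S : Sl2 x h y) (k : ℕ) (v : E) :
    y ((x ^ (k+1)) v) = (x ^ k) (x (y v)) - ((k : ℝ) + 1) • (x ^ k) (h v + (k : ℝ) • v) := by
  induction k generalizing v with
  | zero => simp [S.xy' v]
  | succ k ih =>
    rw [pow_succ, Module.End.mul_apply, ih (x v)]
    have e1 : y (x v) = x (y v) - h v := by rw [S.xy']; abel
    rw [e1, S.hx', pow_succ x k]
    simp only [Module.End.mul_apply, map_add, map_sub, map_smul]
    push_cast
    module

lemma Sl2.hA (S : Sl2 x h y) (v : E) : x (y (h v)) = h (x (y v)) := by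
  rw [S.hx', S.hy']; simp

lemma Sl2.mem_ker (S : Sl2 x h y) (N : ℕ) : ∀ v, (x ^ N) v = 0 → x (y v) = 0 →
    v ∈ ⨆ i : Fin N, V x h y 0 i := by
  induction N with
  | zero => intro v hv _; simp at hv; simp [hv]
  | succ N ih =>
    intro v hv hA
    have h1 : (x ^ N) (h v + (N : ℝ) • v) = 0 := by
      have := S.yxpow N v
      rw [hv, hA] at this
      simp only [map_zero, zero_sub] at this
      have h2 := (neg_eq_zero.mp this.symm)
      rcases smul_eq_zero.mp h2 with h3 | h3
      · exact absurd h3 (by positivity)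
      · exact h3
    have h2 := ih _ h1 (by simp [S.hA, hA])
    have key : ∀ z ∈ ⨆ i : Fin N, V x h y 0 i,
        ∃ z' ∈ ⨆ i : Fin N, V x h y 0 i, h z' + (N : ℝ) • z' = z ∧ x (y z') = 0 := by
      intro z hz
      induction hz using Submodule.iSup_induction' with
      | mem i z hz =>
        have hi : ((N : ℝ) - (i : ℕ)) ≠ 0 := by
          have : ((i : ℕ) : ℝ) < N := by exact_mod_cast i.2
          linarith
        refine ⟨((N : ℝ) - (i : ℕ))⁻¹ • z, Submodule.smul_mem _ _ (Submodule.mem_iSup_of_mem i hz), ?_, ?_⟩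
        · rw [map_smul, hz.1]
          have : ((N : ℝ) - (i : ℕ))⁻¹ • (((0:ℕ) : ℝ) - (i : ℕ)) • z + (N : ℝ) • ((N : ℝ) - (i : ℕ))⁻¹ • z
            = (((N : ℝ) - (i : ℕ))⁻¹ * ((N : ℝ) - (i : ℕ))) • z := by push_cast; module
          rw [this, inv_mul_cancel₀ hi, one_smul]
        · rw [map_smul, map_smul, hz.2]; simp
      | zero => exact ⟨0, Submodule.zero_mem _, by simp, by simp⟩
      | add a b _ _ iha ihb =>
        obtain ⟨a', ha, ha', ha''⟩ := iha
        obtain ⟨b', hb, hb', hb''⟩ := ihb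
        refine ⟨a' + b', Submodule.add_mem _ ha hb, ?_, by simp [ha'', hb'']⟩
        rw [← ha', ← hb', map_add]; module
    obtain ⟨z', hz', e1, e2⟩ := key _ h2
    have hle : (⨆ i : Fin N, V x h y 0 i) ≤ ⨆ i : Fin (N+1), V x h y 0 i :=
      iSup_le fun i => le_iSup_of_le (Fin.castSucc i) (by simp)
    have h5 : v - z' ∈ V x h y 0 N := by
      refine ⟨?_, by simp [hA, e2]⟩
      rw [map_sub]
      have e3 : h v = h z' + (N : ℝ) • z' - (N : ℝ) • v := by rw [e1]; abel
      rw [e3]; push_cast; module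
    have : v = (v - z') + z' := by abel
    rw [this]
    exact Submodule.add_mem _ (Submodule.mem_iSup_of_mem (Fin.last N) (by simpa using h5)) (hle hz')

lemma nilp [FiniteDimensional ℝ E] {a h : Module.End ℝ E} {c : ℝ} (hc : c ≠ 0)
    (H : h * a = a * h + c • a) : ∃ N, a ^ N = 0 := by
  by_contra! hne
  have hk : ∀ k : ℕ, h * a ^ k = a ^ k * h + (c * k) • a ^ k := by
    intro k
    induction k with
    | zero => simp
    | succ k ih =>
      rw [pow_succ, ← mul_assoc, ih, add_mul, mul_assoc, H]
      simp only [mul_add, mul_smul_comm, smul_mul_assoc, mul_assoc]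
      push_cast; module
  let T : Module.End ℝ (Module.End ℝ E) := LinearMap.mulLeft ℝ h - LinearMap.mulRight ℝ h
  have hli := Module.End.eigenvectors_linearIndependent' T (fun k : ℕ => c * k)
    (fun i j hij => by simpa [hc] using hij) (fun k => a ^ k) (fun k => by
      refine ⟨Module.End.mem_eigenspace_iff.mpr ?_, hne k⟩
      simp [T, hk k])
  have := hli.finite_of_isNoetherian
  exact not_finite ℕ

lemma Sl2.pos [FiniteDimensional ℝ E] (S : Sl2 x h y) {z : E} {μ : ℝ} (hμ : 0 < μ)
    (hz : h z = μ • z) (hA : x (y z) = 0) : z = 0 := by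
  obtain ⟨N, hN⟩ := nilp two_ne_zero S.hx
  have : ∀ N : ℕ, (x ^ N) z = 0 → z = 0 := by
    intro N
    induction N with
    | zero => intro h; simpa using h
    | succ N ih =>
      intro hv
      apply ih
      have := S.yxpow N z
      rw [hv, hA, hz, ← add_smul] at this
      simp only [map_zero, zero_sub, map_smul, smul_smul] at this
      have h2 := (neg_eq_zero.mp this.symm)
      rcases smul_eq_zero.mp h2 with h3 | h3
      · exact absurd h3 (by positivity)
      · exact h3
  exact this N (by simp [hN])

lemma Sl2.neg [FiniteDimensional ℝ E] (S : Sl2 x h y) {z : E} {μ : ℝ} (hμ : μ < 0)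
    (hz : h z = μ • z) (hA : y (x z) = 0) : z = 0 :=
  S.symm.pos (μ := -μ) (by linarith) (by rw [LinearMap.neg_apply, hz]; module) hA

lemma Sl2.xV (S : Sl2 x h y) {k l : ℕ} {v : E} (hv : v ∈ V x h y k (l+1)) :
    x v ∈ V x h y (k+1) l := by
  have e1 : y (x v) = x (y v) - h v := by rw [S.xy']; abel
  refine ⟨?_, ?_⟩
  · rw [S.hx', hv.1, map_smul]; push_cast; module
  · rw [e1, hv.1, hv.2, ← sub_smul, map_smul]; push_cast; congr 1; ring

lemma Sl2.yV (S : Sl2 x h y) {k l : ℕ} {v : E} (hv : v ∈ V x h y (k+1) l) :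
    y v ∈ V x h y k (l+1) := by
  rw [V_symm S] at hv ⊢
  exact S.symm.xV hv

lemma Sl2.yx (S : Sl2 x h y) {k l : ℕ} {v : E} (hv : v ∈ V x h y k l) :
    y (x v) = (((k : ℝ) + 1) * l) • v := by
  rw [V_symm S] at hv
  rw [hv.2]; congr 1; ring

lemma Sl2.xV0 [FiniteDimensional ℝ E] (S : Sl2 x h y) {k : ℕ} {v : E} (hv : v ∈ V x h y k 0) :
    x v = 0 := by
  have h1 := S.yx hv
  refine S.pos (μ := (k : ℝ) + 2) (by positivity) ?_ (by simp [h1])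
  rw [S.hx', hv.1, map_smul]; push_cast; module

lemma Sl2.yV0 [FiniteDimensional ℝ E] (S : Sl2 x h y) {l : ℕ} {v : E} (hv : v ∈ V x h y 0 l) :
    y v = 0 := by
  rw [V_symm S] at hv
  exact S.symm.xV0 hv

lemma Sl2.kerA [FiniteDimensional ℝ E] (S : Sl2 x h y) {v : E} (hA : x (y v) = 0) :
    v ∈ ⨆ i : ℕ, V x h y 0 i := by
  obtain ⟨N, hN⟩ := nilp two_ne_zero S.hx
  have := S.mem_ker N v (by simp [hN]) hA
  exact (iSup_le fun i : Fin N => le_iSup (fun i : ℕ => V x h y 0 i) i) this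

lemma Sl2.top [FiniteDimensional ℝ E] (S : Sl2 x h y) :
    (⨆ p : ℕ × ℕ, V x h y p.1 p.2) = ⊤ := by
  set W := ⨆ p : ℕ × ℕ, V x h y p.1 p.2 with hW
  have hA : ∀ v, x (y v) = 0 → v ∈ W := fun v hv =>
    (iSup_le fun i => le_iSup (fun p : ℕ × ℕ => V x h y p.1 p.2) (0, i)) (S.kerA hv)
  have key : ∀ w ∈ W, ∃ z ∈ W, x (w - y z) = 0 := by
    intro w hw
    induction hw using Submodule.iSup_induction' with
    | mem p w hw =>
      obtain ⟨k, l⟩ := p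
      cases l with
      | zero => exact ⟨0, Submodule.zero_mem _, by simpa using S.xV0 hw⟩
      | succ l =>
        have h0 : (((k : ℝ) + 1) * ((l + 1 : ℕ) : ℝ)) ≠ 0 := by positivity
        refine ⟨(((k : ℝ) + 1) * ((l + 1 : ℕ) : ℝ))⁻¹ • x w, Submodule.smul_mem _ _
          (Submodule.mem_iSup_of_mem (k + 1, l) (S.xV hw)), ?_⟩
        rw [map_smul, S.yx hw, smul_smul, inv_mul_cancel₀ h0]; simp
    | zero => exact ⟨0, Submodule.zero_mem _, by simp⟩
    | add a b _ _ iha ihb =>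
      obtain ⟨a', ha, ha'⟩ := iha
      obtain ⟨b', hb, hb'⟩ := ihb
      refine ⟨a' + b', Submodule.add_mem _ ha hb, ?_⟩
      have : a + b - y (a' + b') = (a - y a') + (b - y b') := by rw [map_add]; abel
      rw [this, map_add, ha', hb', add_zero]
  have step : ∀ u, y u ∈ W → u ∈ W := by
    intro u hu
    obtain ⟨z, hz, e⟩ := key _ hu
    have := hA (u - z) (by rw [map_sub]; exact e)
    simpa using Submodule.add_mem _ this hz
  have hyN : h * y = y * h + (-2 : ℝ) • y := by rw [S.hy]; module
  obtain ⟨N, hN⟩ := nilp (by norm_num) hyN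
  have : ∀ N : ℕ, ∀ u, (y ^ N) u ∈ W → u ∈ W := by
    intro N
    induction N with
    | zero => intro u hu; simpa using hu
    | succ N ih =>
      intro u hu
      rw [pow_succ, Module.End.mul_apply] at hu
      exact step _ (ih _ hu)
  rw [eq_top_iff]
  intro u _
  exact this N u (by simp [hN])

lemma Sl2.ext [FiniteDimensional ℝ E] (S : Sl2 x h y) {F : Type*} [AddCommGroup F] [Module ℝ F]
    {f g : E →ₗ[ℝ] F}
    (H : ∀ k l, ∀ v ∈ V x h y k l, f v = g v) : f = g := by
  have : (⊤ : Submodule ℝ E) ≤ LinearMap.eqLocus f g := by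
    rw [← S.top]
    exact iSup_le fun p v hv => H _ _ v hv
  ext v
  exact this (Submodule.mem_top)

lemma Sl2.proj [FiniteDimensional ℝ E] (S : Sl2 x h y) :
    ∃ (s : Finset (ℕ × ℕ)) (Q : ℕ × ℕ → Module.End ℝ E),
      (∀ p, ∀ v ∈ V x h y p.1 p.2, Q p v = v) ∧
      (∀ p p', p ≠ p' → ∀ v ∈ V x h y p'.1 p'.2, Q p v = 0) ∧
      ∑ p ∈ s, Q p = 1 := by
  classical
  let B : Set E := ⋃ p : ℕ × ℕ, (V x h y p.1 p.2 : Set E)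
  have hB : Submodule.span ℝ B = ⊤ := by
    rw [← S.top, Submodule.iSup_eq_span]
  obtain ⟨b, hbB, hbs, hbi⟩ := exists_linearIndependent ℝ B
  let bb : Module.Basis b ℝ E := Module.Basis.mk hbi (by
    rw [Subtype.range_coe, hbs, hB])
  have hbb : ∀ i, bb i = i := fun i => by simp [bb]
  have : Fintype b := FiniteDimensional.fintypeBasisIndex bb
  have hp : ∀ i : b, ∃ p : ℕ × ℕ, bb i ∈ V x h y p.1 p.2 := by
    intro i
    rw [hbb]
    simpa [B] using hbB i.2
  choose p hp using hp
  have hH : ∀ v i, bb.repr (h v) i = (((p i).1 : ℝ) - (p i).2) * bb.repr v i := by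
    intro v i
    have : (bb.coord i) ∘ₗ h = (((p i).1 : ℝ) - (p i).2) • bb.coord i := by
      apply bb.ext
      intro j
      simp only [LinearMap.comp_apply, (hp j).1, map_smul, LinearMap.smul_apply, Module.Basis.coord_apply,
        Module.Basis.repr_self, Finsupp.single_apply, smul_eq_mul]
      split_ifs with hij
      · rw [hij]
      · simp
    simpa using congrArg (fun f => f v) this
  have hA : ∀ v i, bb.repr (x (y v)) i = (((p i).1 : ℝ) * ((p i).2 + 1)) * bb.repr v i := by
    intro v i
    have : (bb.coord i) ∘ₗ (x ∘ₗ y) = (((p i).1 : ℝ) * ((p i).2 + 1)) • bb.coord i := by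
      apply bb.ext
      intro j
      simp only [LinearMap.comp_apply, (hp j).2, map_smul, LinearMap.smul_apply, Module.Basis.coord_apply,
        Module.Basis.repr_self, Finsupp.single_apply, smul_eq_mul]
      split_ifs with hij
      · rw [hij]
      · simp
    simpa using congrArg (fun f => f v) this
  have hz : ∀ (q : ℕ × ℕ) v i, v ∈ V x h y q.1 q.2 → p i ≠ q → bb.repr v i = 0 := by
    intro q v i hv hne
    by_contra h0
    apply hne
    have e1 := hH v i
    have e2 := hA v i
    rw [hv.1, map_smul, Finsupp.smul_apply, smul_eq_mul] at e1
    rw [hv.2, map_smul, Finsupp.smul_apply, smul_eq_mul] at e2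
    have e1 := mul_right_cancel₀ h0 e1
    have e2 := mul_right_cancel₀ h0 e2
    have f1 : (q.1 : ℤ) - q.2 = (p i).1 - (p i).2 := by exact_mod_cast e1
    have f2 : (q.1 : ℤ) * (q.2 + 1) = (p i).1 * ((p i).2 + 1) := by exact_mod_cast e2
    have f3 : ((q.1 : ℤ) - (p i).1) * (q.1 + (p i).2 + 1) = 0 := by
      have : (q.2 : ℤ) = q.1 - (p i).1 + (p i).2 := by linarith
      rw [this] at f2
      linarith [f2]
    have f4 : (q.1 : ℤ) - (p i).1 = 0 := by
      rcases mul_eq_zero.mp f3 with h | h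
      · exact h
      · omega
    ext <;> omega
  let Q : ℕ × ℕ → Module.End ℝ E := fun q => bb.constr ℝ (fun i => if p i = q then bb i else 0)
  have hQ : ∀ q v, Q q v = ∑ i, bb.repr v i • (if p i = q then bb i else 0) := by
    intro q v
    simp [Q, Module.Basis.constr_apply_fintype]
  refine ⟨Finset.univ.image p, Q, ?_, ?_, ?_⟩
  · intro q v hv
    rw [hQ]
    conv_rhs => rw [← bb.sum_repr v]
    refine Finset.sum_congr rfl fun i _ => ?_
    split_ifs with hi
    · rfl
    · rw [hz q v i hv hi]; simp
  · intro q q' hne v hv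
    rw [hQ]
    refine Finset.sum_eq_zero fun i _ => ?_
    split_ifs with hi
    · rw [hz q' v i hv (by rw [hi]; exact hne)]; simp
    · simp
  · apply bb.ext
    intro i
    simp only [LinearMap.sum_apply, Q, Module.Basis.constr_basis]
    rw [Finset.sum_ite_eq]
    simp

end Rep
end Slice

namespace Slice

section Shift
set_option linter.unusedSectionVars false
variable {E : Type*} [AddCommGroup E] [Module ℝ E] [FiniteDimensional ℝ E]
variable {x h y : Module.End ℝ E}

lemma proj_sum {s : Finset (ℕ × ℕ)} {Q : ℕ × ℕ → Module.End ℝ E}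
    (h1 : ∀ p, ∀ v ∈ V x h y p.1 p.2, Q p v = v)
    (h2 : ∀ p p', p ≠ p' → ∀ v ∈ V x h y p'.1 p'.2, Q p v = 0)
    (h3 : ∑ p ∈ s, Q p = 1) (L : ℕ × ℕ → Module.End ℝ E) (p : ℕ × ℕ) (v : E)
    (hv : v ∈ V x h y p.1 p.2) : (∑ p ∈ s, L p * Q p) v = L p v := by
  have key : ∀ L : ℕ × ℕ → Module.End ℝ E,
      (∑ p ∈ s, L p * Q p) v = if p ∈ s then L p v else 0 := by
    intro L
    rw [LinearMap.sum_apply, ← Finset.sum_ite_eq s p (fun p => L p v)]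
    refine Finset.sum_congr rfl fun p' _ => ?_
    rw [Module.End.mul_apply]
    split_ifs with hp
    · subst hp; rw [h1 _ _ hv]
    · rw [h2 p' p (fun h => hp h.symm) _ hv, map_zero]
  rw [key]
  split_ifs with hp
  · rfl
  · have := key 1
    simp only [Pi.one_apply, one_mul, h3, Module.End.one_apply, if_neg hp] at this
    rw [this, map_zero]

lemma Sl2.extend (S : Sl2 x h y) (L : ℕ → ℕ → Module.End ℝ E) :
    ∃ u : Module.End ℝ E, ∀ k l, ∀ v ∈ V x h y k l, u v = L k l v := by
  obtain ⟨s, Q, h1, h2, h3⟩ := S.proj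
  exact ⟨_, fun k l v hv => proj_sum h1 h2 h3 (fun p => L p.1 p.2) (k, l) v hv⟩

/-- pseudo-inverse of `x` -/
structure IsR (x h y R : Module.End ℝ E) : Prop where
  rV : ∀ {k l v}, v ∈ V x h y (k+1) l → R v ∈ V x h y k (l+1)
  xr : ∀ {k l v}, v ∈ V x h y (k+1) l → x (R v) = v
  r0 : ∀ {l v}, v ∈ V x h y 0 l → R v = 0
  rx : ∀ {k l v}, v ∈ V x h y k (l+1) → R (x v) = v
  rker : ∀ {v}, y v = 0 → R v = 0
  yxr : ∀ v, y (x (R v)) = y v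
  xrx : ∀ v, x (R (x v)) = x v
  hr : h * R = R * h - (2 : ℝ) • R

lemma Sl2.exR (S : Sl2 x h y) : ∃ R, IsR x h y R := by
  obtain ⟨T, hT⟩ := S.extend (fun k l => ((((k : ℝ) + 1) * l)⁻¹ : ℝ) • 1)
  have a0 : ∀ {l v}, v ∈ V x h y 0 l → (T * y) v = 0 := by
    intro l v hv
    simp [S.yV0 hv]
  have a1 : ∀ {k l v}, v ∈ V x h y (k+1) l → (T * y) v = ((((k : ℝ) + 1) * (l + 1))⁻¹ : ℝ) • y v := by
    intro k l v hv
    rw [Module.End.mul_apply, hT _ _ _ (S.yV hv)]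
    simp
  have a2 : ∀ {k l v}, v ∈ V x h y (k+1) l → x ((T * y) v) = v := by
    intro k l v hv
    rw [a1 hv, map_smul, hv.2, smul_smul]
    push_cast
    rw [inv_mul_cancel₀ (by positivity), one_smul]
  have a3 : ∀ {k l v}, v ∈ V x h y k (l+1) → (T * y) (x v) = v := by
    intro k l v hv
    rw [a1 (S.xV hv), S.yx hv, smul_smul]
    push_cast
    rw [inv_mul_cancel₀ (by positivity), one_smul]
  refine ⟨T * y, ⟨?_, a2, a0, a3, ?_, ?_, ?_, ?_⟩⟩
  · intro k l v hv
    rw [a1 hv]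
    exact Submodule.smul_mem _ _ (S.yV hv)
  · intro v hv
    simp [hv]
  · intro v
    have : y * x * (T * y) = y := by
      apply S.ext
      intro k l v hv
      cases k with
      | zero => rw [Module.End.mul_apply, a0 hv, map_zero, S.yV0 hv]
      | succ k => rw [Module.End.mul_apply, Module.End.mul_apply, a2 hv]
    exact congrArg (fun f => f v) this
  · intro v
    have : x * (T * y) * x = x := by
      apply S.ext
      intro k l v hv
      cases l with
      | zero => rw [Module.End.mul_apply, S.xV0 hv, map_zero]
      | succ k => rw [Module.End.mul_apply, Module.End.mul_apply, a3 hv]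
    exact congrArg (fun f => f v) this
  · apply S.ext
    intro k l v hv
    cases k with
    | zero => simp only [Module.End.mul_apply, LinearMap.sub_apply, LinearMap.smul_apply, hv.1, S.yV0 hv, map_smul, map_zero]; simp
    | succ k =>
      have hw := (S.yV hv).1
      rw [LinearMap.sub_apply, LinearMap.smul_apply, Module.End.mul_apply h (T * y), Module.End.mul_apply (T * y) h, hv.1, map_smul, a1 hv, map_smul, hw]
      push_cast
      module

variable {R : Module.End ℝ E}

lemma IsR.xpow (S : Sl2 x h y) (I : IsR x h y R) (j : ℕ) : ∀ {k l : ℕ} {v : E},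
    v ∈ V x h y k (l + j) → (x ^ j) v ∈ V x h y (k + j) l ∧ (R ^ j) ((x ^ j) v) = v := by
  induction j with
  | zero => intro k l v hv; simpa using hv
  | succ j ih =>
    intro k l v hv
    have h1 := S.xV (l := l + j) hv
    have h2 := ih h1
    rw [pow_succ x, Module.End.mul_apply, pow_succ' R, Module.End.mul_apply, h2.2]
    refine ⟨?_, I.rx (l := l + j) hv⟩
    have e : k + (j + 1) = k + 1 + j := by ring
    rw [e]; exact h2.1

lemma IsR.xpow0 (S : Sl2 x h y) (j : ℕ) : ∀ {k l : ℕ} {v : E},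
    v ∈ V x h y k l → l < j → (x ^ j) v = 0 := by
  induction j with
  | zero => intro k l v _ hl; omega
  | succ j ih =>
    intro k l v hv hl
    rw [pow_succ, Module.End.mul_apply]
    cases l with
    | zero => rw [S.xV0 hv, map_zero]
    | succ l => exact ih (S.xV hv) (by omega)

lemma IsR.rpow (I : IsR x h y R) (j : ℕ) : ∀ {k l : ℕ} {v : E},
    v ∈ V x h y (k + j) l → (R ^ j) v ∈ V x h y k (l + j) ∧ (x ^ j) ((R ^ j) v) = v := by
  induction j with
  | zero => intro k l v hv; simpa using hv
  | succ j ih =>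
    intro k l v hv
    have h1 := I.rV (k := k + j) hv
    have h2 := ih h1
    rw [pow_succ R, Module.End.mul_apply, pow_succ' x, Module.End.mul_apply, h2.2]
    refine ⟨?_, I.xr (k := k + j) hv⟩
    have e : l + (j + 1) = l + 1 + j := by ring
    rw [e]; exact h2.1

lemma IsR.xrxpow (S : Sl2 x h y) (I : IsR x h y R) (j : ℕ) : x ^ j * R ^ j * x ^ j = x ^ j := by
  apply S.ext
  intro k l v hv
  rw [Module.End.mul_apply, Module.End.mul_apply]
  by_cases hl : l < j
  · rw [IsR.xpow0 S j hv hl]; simp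
  · obtain ⟨m, rfl⟩ := Nat.exists_eq_add_of_le' (not_lt.mp hl)
    rw [(I.xpow S j hv).2]

end Shift

section Filt
variable {E : Type*} [AddCommGroup E] [Module ℝ E]

def ad (X : Module.End ℝ E) : Module.End ℝ (Module.End ℝ E) :=
  LinearMap.mulLeft ℝ X - LinearMap.mulRight ℝ X

lemma ad_apply (X w : Module.End ℝ E) : ad X w = X * w - w * X := by simp [ad]

lemma Sl2.adj {x h y : Module.End ℝ E} (S : Sl2 x h y) : Sl2 (ad x) (ad h) (ad y) where
  hx := by
    apply LinearMap.ext; intro w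
    have e : (2 : ℝ) • x = h * x - x * h := by rw [S.hx]; abel
    have e2 : (2 : ℝ) • Slice.ad x w = (h * x - x * h) * w - w * (h * x - x * h) := by
      rw [← e, ad_apply]; simp [smul_sub]
    simp only [Module.End.mul_apply, LinearMap.add_apply, LinearMap.smul_apply, e2]
    simp only [ad_apply]; noncomm_ring
  hy := by
    apply LinearMap.ext; intro w
    have e : (2 : ℝ) • y = y * h - h * y := by rw [S.hy]; abel
    have e2 : (2 : ℝ) • Slice.ad y w = (y * h - h * y) * w - w * (y * h - h * y) := by
      rw [← e, ad_apply]; simp [smul_sub]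
    simp only [Module.End.mul_apply, LinearMap.sub_apply, LinearMap.smul_apply, e2]
    simp only [ad_apply]; noncomm_ring
  xy := by
    apply LinearMap.ext; intro w
    have e : h = x * y - y * x := by rw [S.xy]; abel
    simp only [Module.End.mul_apply, LinearMap.add_apply]
    rw [e]
    simp only [ad_apply]; noncomm_ring

/-- filtration of the endomorphism algebra by weights of `ad H` -/
def G (H : Module.End ℝ E) (a : ℤ) : Submodule ℝ (Module.End ℝ E) :=
  Submodule.span ℝ {w | ∃ b : ℤ, b ≤ a ∧ ad H w = (b : ℝ) • w}

variable {H : Module.End ℝ E}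

lemma G_mono {a b : ℤ} (hab : a ≤ b) : G H a ≤ G H b :=
  Submodule.span_mono fun _ ⟨c, h1, h2⟩ => ⟨c, h1.trans hab, h2⟩

lemma G_of {a : ℤ} {w : Module.End ℝ E} (hw : ad H w = (a : ℝ) • w) : w ∈ G H a :=
  Submodule.subset_span ⟨a, le_rfl, hw⟩

lemma G_mul {a b : ℤ} {v w : Module.End ℝ E} (hv : v ∈ G H a) (hw : w ∈ G H b) :
    v * w ∈ G H (a + b) := by
  have h1 := Submodule.mul_mem_mul hv hw
  rw [G, G, Submodule.span_mul_span] at h1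
  refine Submodule.span_le.mpr ?_ h1
  rintro _ ⟨v, ⟨c, hc, hv⟩, w, ⟨d, hd, hw⟩, rfl⟩
  refine Submodule.subset_span ⟨c + d, by omega, ?_⟩
  have : ad H (v * w) = ad H v * w + v * ad H w := by simp only [ad_apply]; noncomm_ring
  show ad H (v * w) = _
  rw [this, hv, hw]
  simp only [smul_mul_assoc, mul_smul_comm]
  push_cast; module

lemma G_mul' {a b c : ℤ} {v w : Module.End ℝ E} (hv : v ∈ G H a) (hw : w ∈ G H b) (h : a + b ≤ c) :
    v * w ∈ G H c := G_mono h (G_mul hv hw)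

lemma G_one : (1 : Module.End ℝ E) ∈ G H 0 := G_of (by simp [ad_apply])

lemma G_lead {a : ℤ} {w : Module.End ℝ E} (hw : w ∈ G H a) :
    ∃ w0, ad H w0 = (a : ℝ) • w0 ∧ w - w0 ∈ G H (a - 1) := by
  induction hw using Submodule.span_induction with
  | mem w hw =>
    obtain ⟨b, hb, hw⟩ := hw
    rcases hb.eq_or_lt with rfl | hlt
    · exact ⟨w, hw, by simp⟩
    · exact ⟨0, by simp, by rw [sub_zero]; exact Submodule.subset_span ⟨b, by omega, hw⟩⟩
  | zero => exact ⟨0, by simp, by simp⟩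
  | add u v _ _ iu iv =>
    obtain ⟨u0, h1, h2⟩ := iu
    obtain ⟨v0, h3, h4⟩ := iv
    refine ⟨u0 + v0, by rw [map_add, h1, h3, smul_add], ?_⟩
    have : u + v - (u0 + v0) = (u - u0) + (v - v0) := by abel
    rw [this]; exact Submodule.add_mem _ h2 h4
  | smul c u _ iu =>
    obtain ⟨u0, h1, h2⟩ := iu
    refine ⟨c • u0, by rw [map_smul, h1, smul_comm], ?_⟩
    rw [← smul_sub]; exact Submodule.smul_mem _ _ h2

lemma G_zero {a b : ℤ} {w : Module.End ℝ E} (hw : w ∈ G H b) (hab : b < a)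
    (h : ad H w = (a : ℝ) • w) : w = 0 := by
  have hi := Module.End.eigenspaces_iSupIndep (ad H) (a : ℝ)
  rw [Submodule.disjoint_def] at hi
  apply hi w (Module.End.mem_eigenspace_iff.mpr h)
  refine Submodule.span_le.mpr ?_ hw
  rintro v ⟨c, hc, hv⟩
  have hne : (c : ℝ) ≠ a := by
    have : c < a := by omega
    exact_mod_cast this.ne
  exact Submodule.mem_iSup_of_mem (c : ℝ) (Submodule.mem_iSup_of_mem hne
    (Module.End.mem_eigenspace_iff.mpr hv))

lemma G_bot [FiniteDimensional ℝ E] : ∃ N : ℕ, G H (-(N : ℤ)) = ⊥ := by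
  obtain ⟨B, hB⟩ := (Module.End.finite_hasEigenvalue (ad H)).bddBelow
  obtain ⟨N, hN⟩ := exists_nat_gt (-B)
  refine ⟨N, ?_⟩
  rw [eq_bot_iff, G, Submodule.span_le]
  rintro w ⟨b, hb, hw⟩
  by_contra hne
  have := hB (Module.End.hasEigenvalue_of_hasEigenvector
    ⟨Module.End.mem_eigenspace_iff.mpr hw, hne⟩)
  have hb' : (b : ℝ) ≤ -(N : ℝ) := by exact_mod_cast hb
  linarith

lemma G_pow {a : ℤ} {w : Module.End ℝ E} (hw : w ∈ G H a) (k : ℕ) : w ^ k ∈ G H (a * k) := by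
  induction k with
  | zero => simpa using G_one
  | succ k ih => 
    rw [pow_succ]; exact G_mul' ih hw (by push_cast; linarith)

lemma G_inv [FiniteDimensional ℝ E] {z : Module.End ℝ E} (hz : z ∈ G H (-1)) :
    ∃ s : Module.End ℝ E, s * (1 + z) = 1 ∧ (1 + z) * s = 1 ∧ s - 1 ∈ G H (-1) := by
  obtain ⟨N, hN⟩ := G_bot (H := H)
  have hz' := Submodule.neg_mem _ hz
  have h0 : (-z) ^ (N + 1) = 0 := by
    have h1 := G_mono (H := H) (b := -(N : ℤ)) (by push_cast; omega) (G_pow hz' (N+1))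
    rw [hN] at h1; exact (Submodule.mem_bot ℝ).mp h1
  refine ⟨∑ i ∈ Finset.range (N + 1), (-z) ^ i, ?_, ?_, ?_⟩
  · have := geom_sum_mul_neg (-z) (N + 1)
    rwa [sub_neg_eq_add, h0, sub_zero] at this
  · have := mul_neg_geom_sum (-z) (N + 1)
    rwa [sub_neg_eq_add, h0, sub_zero] at this
  · rw [Finset.sum_range_succ', pow_zero, add_sub_cancel_right]
    refine Submodule.sum_mem _ fun i _ => ?_
    exact G_mono (by push_cast; omega) (G_pow hz' (i+1))

end Filt
end Slice

namespace Slice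

section Core
set_option linter.unusedSectionVars false
variable {E : Type*} [AddCommGroup E] [Module ℝ E] 

/-- partial products `∏_{i<k} (M - e i)` -/
def P (M : Module.End ℝ E) (e : ℕ → ℝ) : ℕ → Module.End ℝ E
  | 0 => 1
  | k + 1 => (M - e k • 1) * P M e k

variable [FiniteDimensional ℝ E]
variable {X H Y R : Module.End ℝ E}

lemma Sl2.XG (S : Sl2 X H Y) : X ∈ G H 2 := G_of (by rw [ad_apply, S.hx]; push_cast; abel)
lemma Sl2.YG (S : Sl2 X H Y) : Y ∈ G H (-2) := G_of (by rw [ad_apply, S.hy]; push_cast; module)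
lemma IsR.RG (I : IsR X H Y R) : R ∈ G H (-2) := G_of (by rw [ad_apply, I.hr]; push_cast; module)

lemma Sl2.P_G (S : Sl2 X H Y) {M : Module.End ℝ E} (hM : M - X ∈ G H 0) (e : ℕ → ℝ) (k : ℕ) :
    P M e k - X ^ k ∈ G H (2 * k - 1) := by
  induction k with
  | zero => simp [P]
  | succ k ih =>
    have h1 : M - X - e k • 1 ∈ G H 0 := Submodule.sub_mem _ hM (Submodule.smul_mem _ _ G_one)
    have e1 : P M e (k+1) - X ^ (k+1) = X * (P M e k - X ^ k) + (M - X - e k • 1) * X ^ k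
        + (M - X - e k • 1) * (P M e k - X ^ k) := by
      rw [P, pow_succ']; noncomm_ring
    rw [e1]
    refine Submodule.add_mem _ (Submodule.add_mem _ ?_ ?_) ?_
    · exact G_mul' S.XG ih (by push_cast; linarith)
    · exact G_mul' h1 (G_pow S.XG k) (by push_cast; linarith)
    · exact G_mul' h1 ih (by push_cast; linarith)

lemma Sl2.kerB (S : Sl2 X H Y) (I : IsR X H Y R) (j : ℕ) {T : Module.End ℝ E}
    (hT : T - X ^ j ∈ G H (2 * j - 1)) :
    ∃ s : Module.End ℝ E, s - 1 ∈ G H (-1) ∧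
      Module.finrank ℝ (LinearMap.ker T) ≤ Module.finrank ℝ (LinearMap.ker (X ^ j)) ∧
      (Module.finrank ℝ (LinearMap.ker (X ^ j)) ≤ Module.finrank ℝ (LinearMap.ker T) →
        ∀ v, (X ^ j) v = 0 → T (s v) = 0) := by
  have hz : R ^ j * (T - X ^ j) ∈ G H (-1) :=
    G_mul' (G_pow I.RG j) hT (by linarith)
  obtain ⟨s, h1, h2, h3⟩ := G_inv hz
  have key : X ^ j * (1 + R ^ j * (T - X ^ j)) = X ^ j * R ^ j * T := by
    have := I.xrxpow S j
    rw [mul_add, mul_sub, mul_one, mul_sub, ← mul_assoc, ← mul_assoc, this]; abel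
  set z := R ^ j * (T - X ^ j)
  have hle : LinearMap.ker T ≤ LinearMap.ker (X ^ j * R ^ j * T) := by
    intro v hv
    rw [LinearMap.mem_ker] at hv ⊢
    rw [Module.End.mul_apply, hv, map_zero]
  have hle2 : LinearMap.ker (X ^ j * R ^ j * T) ≤ (LinearMap.ker (X ^ j)).map s := by
    intro v hv
    refine ⟨(1 + z) v, ?_, ?_⟩
    · rw [← key] at hv; exact hv
    · rw [← Module.End.mul_apply, h1]; rfl
  have hf : Module.finrank ℝ (LinearMap.ker (X ^ j * R ^ j * T)) ≤
      Module.finrank ℝ (LinearMap.ker (X ^ j)) :=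
    (Submodule.finrank_mono hle2).trans (Submodule.finrank_map_le _ _)
  refine ⟨s, h3, (Submodule.finrank_mono hle).trans hf, ?_⟩
  intro hge v hv
  have heq := Submodule.eq_of_le_of_finrank_le hle (hf.trans hge)
  have : s v ∈ LinearMap.ker (X ^ j * R ^ j * T) := by
    rw [LinearMap.mem_ker, ← key]
    rw [Module.End.mul_apply, ← Module.End.mul_apply (1 + z) s, h2]
    exact hv
  rw [← heq] at this
  exact this

lemma Sl2.centG (S : Sl2 X H Y) {C : Module.End ℝ E} (hC : C * Y = Y * C) : C ∈ G H 0 := by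
  have h1 : ad Y C = 0 := by rw [ad_apply, hC, sub_self]
  have h2 := S.adj.kerA (v := C) (by rw [h1, map_zero])
  refine (iSup_le fun i => ?_ : (⨆ i : ℕ, V (ad X) (ad H) (ad Y) 0 i) ≤ G H 0) h2
  intro v hv
  refine Submodule.subset_span ⟨-(i : ℤ), by omega, ?_⟩
  rw [hv.1]; push_cast; simp

lemma Sl2.exD (S : Sl2 X H Y) (e : ℕ → ℝ) : ∃ D : Module.End ℝ E, D ∈ G H 0 ∧
    (∀ k l, ∀ v ∈ V X H Y k l, D v = e k • v) := by
  obtain ⟨D, hD⟩ := S.extend (fun k l => e k • 1)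
  have hD' : ∀ k l, ∀ v ∈ V X H Y k l, D v = e k • v := by
    intro k l v hv; rw [hD k l v hv]; simp
  refine ⟨D, G_of ?_, hD'⟩
  have : H * D = D * H := by
    apply S.ext
    intro k l v hv
    rw [Module.End.mul_apply, Module.End.mul_apply, hD' k l v hv, hv.1, map_smul, map_smul, hv.1,
      hD' k l v hv, smul_comm]
  rw [ad_apply, this]; simp

lemma Sl2.P_M0 (S : Sl2 X H Y) (I : IsR X H Y R) {e : ℕ → ℝ} {D : Module.End ℝ E}
    (hD : ∀ k l, ∀ v ∈ V X H Y k l, D v = e k • v) (k : ℕ) :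
    ∃ W, P (X + D) e k = X ^ k * W := by
  induction k with
  | zero => exact ⟨1, by simp [P]⟩
  | succ k ih =>
    obtain ⟨W, hW⟩ := ih
    have key : X ^ (k+1) * R ^ (k+1) * ((D - e k • 1) * X ^ k) = (D - e k • 1) * X ^ k := by
      apply S.ext
      intro a b v hv
      by_cases hb : b < k
      · simp [Module.End.mul_apply, IsR.xpow0 S k hv hb]
      · obtain ⟨m, rfl⟩ := Nat.exists_eq_add_of_le' (not_lt.mp hb)
        have h1 := (I.xpow S k hv).1
        have h2 : ((D - e k • 1) * X ^ k) v = (e (a + k) - e k) • (X ^ k) v := by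
          rw [Module.End.mul_apply, LinearMap.sub_apply, hD _ _ _ h1]
          simp [sub_smul]
        rw [Module.End.mul_apply, h2]
        cases a with
        | zero => simp
        | succ a =>
          have e1 : a + 1 + k = a + (k + 1) := by ring
          rw [e1] at h1
          rw [map_smul, Module.End.mul_apply, (I.rpow (k+1) h1).2]
    refine ⟨W + R ^ (k+1) * ((D - e k • 1) * X ^ k) * W, ?_⟩
    rw [mul_add, ← mul_assoc (X ^ (k+1)), ← mul_assoc (X ^ (k+1)), key, P, hW]
    rw [pow_succ']; noncomm_ring

lemma Sl2.finrank_P_M0 (S : Sl2 X H Y) {e : ℕ → ℝ} {D : Module.End ℝ E} (hDG : D ∈ G H 0)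
    (hD : ∀ k l, ∀ v ∈ V X H Y k l, D v = e k • v) (k : ℕ) :
    Module.finrank ℝ (LinearMap.ker (P (X + D) e k)) = Module.finrank ℝ (LinearMap.ker (X ^ k)) := by
  obtain ⟨R, I⟩ := S.exR
  apply le_antisymm
  · obtain ⟨_, _, h, _⟩ := S.kerB I k (S.P_G (M := X + D) (by simpa using hDG) e k)
    exact h
  · obtain ⟨W, hW⟩ := S.P_M0 I hD k
    have h1 : LinearMap.range (P (X + D) e k) ≤ LinearMap.range (X ^ k) := by
      rw [hW]; exact LinearMap.range_comp_le_range _ _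
    have h2 := Submodule.finrank_mono h1
    have h3 := LinearMap.finrank_range_add_finrank_ker (P (X + D) e k)
    have h4 := LinearMap.finrank_range_add_finrank_ker (X ^ k)
    omega

lemma Sl2.intertwine (S : Sl2 X H Y) {e : ℕ → ℝ} {D M : Module.End ℝ E}
    (hD : ∀ k l, ∀ v ∈ V X H Y k l, D v = e k • v) (hM : M - X ∈ G H 0)
    (hker : ∀ k, Module.finrank ℝ (LinearMap.ker (X ^ k)) ≤ Module.finrank ℝ (LinearMap.ker (P M e k))) :
    ∃ u, u - 1 ∈ G H (-1) ∧ u * (X + D) = M * u := by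
  obtain ⟨R, I⟩ := S.exR
  have hs := fun j => S.kerB I j (S.P_G hM e j)
  choose s hs1 _ hs2 using hs
  obtain ⟨t, Q, h1, h2, h3⟩ := S.proj
  let L : ℕ × ℕ → Module.End ℝ E := fun p => P M e p.1 * s (p.1 + p.2 + 1) * R ^ p.1
  have hu := proj_sum h1 h2 h3 L
  have hone : ∑ p ∈ t, (X ^ p.1 * R ^ p.1) * Q p = 1 := by
    apply S.ext
    intro k l v hv
    rw [proj_sum h1 h2 h3 (fun p => X ^ p.1 * R ^ p.1) (k, l) v hv, Module.End.mul_apply]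
    rw [(I.rpow (k := 0) k (by simpa using hv)).2]; rfl
  have hQ : ∀ p, Q p ∈ G H 0 := by
    intro p
    apply G_of
    have : H * Q p = Q p * H := by
      apply S.ext
      intro k l v hv
      rw [Module.End.mul_apply, Module.End.mul_apply, hv.1, map_smul]
      by_cases hp : p = (k, l)
      · subst hp; rw [h1 _ v hv, hv.1]
      · rw [h2 p (k, l) hp v hv]; simp
    rw [ad_apply, this]; simp
  refine ⟨∑ p ∈ t, L p * Q p, ?_, ?_⟩
  · rw [← hone, ← Finset.sum_sub_distrib]
    refine Submodule.sum_mem _ fun p _ => ?_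
    rw [← sub_mul]
    refine G_mul' (a := -1) (b := 0) ?_ (hQ p) (by norm_num)
    have e1 : L p - X ^ p.1 * R ^ p.1 =
        (P M e p.1 - X ^ p.1) * (s (p.1 + p.2 + 1) * R ^ p.1) + X ^ p.1 * ((s (p.1 + p.2 + 1) - 1) * R ^ p.1) := by
      simp only [L]; noncomm_ring
    have hs0 : s (p.1 + p.2 + 1) ∈ G H 0 := by
      have := Submodule.add_mem _ (G_mono (by norm_num : (-1 : ℤ) ≤ 0) (hs1 (p.1 + p.2 + 1))) (G_one (H := H))
      simpa using this
    rw [e1]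
    refine Submodule.add_mem _ ?_ ?_
    · exact G_mul' (S.P_G hM e p.1) (G_mul hs0 (G_pow I.RG p.1)) (by linarith)
    · exact G_mul' (G_pow S.XG p.1) (G_mul (hs1 _) (G_pow I.RG p.1)) (by linarith)
  · apply S.ext
    intro k l v hv
    have hMP : ∀ w, M (P M e k w) = P M e (k+1) w + e k • P M e k w := by
      intro w; rw [P]; simp [Module.End.mul_apply]
    rw [Module.End.mul_apply, Module.End.mul_apply, LinearMap.add_apply, map_add, hD k l v hv,
      map_smul, hu (k, l) v hv]
    simp only [L, Module.End.mul_apply]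
    rw [hMP]
    congr 1
    cases l with
    | zero =>
      rw [S.xV0 hv, map_zero]
      have h4 := (I.rpow (k := 0) k (by simpa using hv)).1
      exact (hs2 (k + 0 + 1) (hker _) _ (IsR.xpow0 S _ h4 (by omega))).symm
    | succ l =>
      rw [hu (k+1, l) _ (S.xV hv)]
      simp only [L, Module.End.mul_apply]
      rw [pow_succ R, Module.End.mul_apply, I.rx hv]
      have : k + 1 + l + 1 = k + (l + 1) + 1 := by ring
      rw [this]

lemma Sl2.exists_slice (S : Sl2 X H Y) {D : Module.End ℝ E} (hD : D ∈ G H 0) :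
    ∃ u C, u - 1 ∈ G H (-1) ∧ C * Y = Y * C ∧ u * (X + D) = (X + C) * u := by
  obtain ⟨R, I⟩ := S.adj.exR
  have key : ∀ j : ℕ, ∃ u C, u - 1 ∈ G H (-1) ∧ C * Y = Y * C ∧
      u * (X + D) - (X + C) * u ∈ G H (-(j : ℤ)) := by
    intro j
    induction j with
    | zero => exact ⟨1, 0, by simp, by simp, by simpa using hD⟩
    | succ j ih =>
      obtain ⟨u, C, h1, h2, h3⟩ := ih
      obtain ⟨e0, h4, h5⟩ := G_lead h3
      set w := R e0 with hw
      have hwG : w ∈ G H (-(j : ℤ) - 2) := by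
        apply G_of
        have := congrArg (fun f => f e0) I.hr
        simp only [Module.End.mul_apply, LinearMap.sub_apply, LinearMap.smul_apply, h4, map_smul] at this
        rw [hw, this]; push_cast; module
      set c := e0 - ad X w with hc
      have hcY : c * Y = Y * c := by
        have : ad Y c = 0 := by rw [hc, map_sub, hw, I.yxr, sub_self]
        rw [ad_apply] at this
        exact (sub_eq_zero.mp this).symm
      have hcG : c ∈ G H (-(j : ℤ)) := by
        rw [hc, ad_apply]
        exact Submodule.sub_mem _ (G_of h4) (Submodule.sub_mem _
          (G_mul' S.XG hwG (by linarith)) (G_mul' hwG S.XG (by linarith)))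
      refine ⟨u + w, C + c, ?_, by rw [add_mul, mul_add, h2, hcY], ?_⟩
      · have : u + w - 1 = (u - 1) + w := by abel
        rw [this]
        exact Submodule.add_mem _ h1 (G_mono (by omega) hwG)
      · have e1 : (u + w) * (X + D) - (X + (C + c)) * (u + w) =
            (u * (X + D) - (X + C) * u - e0) + w * D - C * w - c * (u - 1) - c * w := by
          have : e0 = c + (X * w - w * X) := by rw [hc, ad_apply]; abel
          rw [this]; noncomm_ring
        rw [e1]
        have hCG := S.centG h2
        refine Submodule.sub_mem _ (Submodule.sub_mem _ (Submodule.sub_mem _ (Submodule.add_mem _ ?_ ?_) ?_) ?_) ?_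
        · exact G_mono (by push_cast; omega) h5
        · exact G_mul' hwG hD (by push_cast; omega)
        · exact G_mul' hCG hwG (by push_cast; omega)
        · exact G_mul' hcG h1 (by push_cast; omega)
        · exact G_mul' hcG hwG (by push_cast; omega)
  obtain ⟨N, hN⟩ := G_bot (H := H)
  obtain ⟨u, C, h1, h2, h3⟩ := key N
  rw [hN] at h3
  exact ⟨u, C, h1, h2, sub_eq_zero.mp ((Submodule.mem_bot ℝ).mp h3)⟩

lemma Sl2.endgame (S : Sl2 X H Y) {D u u0 C C1 : Module.End ℝ E} (hD : D ∈ G H 0)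
    (hu : u - 1 ∈ G H (-1)) (hu0 : u0 - 1 ∈ G H (-1)) (hC : C * Y = Y * C) (hC1 : C1 * Y = Y * C1)
    (h1 : u * (X + D) = (X + C) * u) (h2 : u0 * (X + D) = (X + C1) * u0) : C = C1 := by
  obtain ⟨R, I⟩ := S.adj.exR
  set w := u - u0 with hw
  set δ := C - C1 with hδ
  have hδY : ad Y δ = 0 := by
    rw [ad_apply, hδ, mul_sub, sub_mul, hC, hC1, sub_self]
  have hCG := S.centG hC
  have hid : ad X w + δ = w * D - C * w - δ * (u0 - 1) := by
    have e1 : u * X = (X + C) * u - u * D := by rw [← h1]; noncomm_ring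
    have e2 : u0 * X = (X + C1) * u0 - u0 * D := by rw [← h2]; noncomm_ring
    rw [ad_apply, hw, hδ, sub_mul u u0 X, e1, e2]; noncomm_ring
  have key : ∀ j : ℕ, w ∈ G H (-1 - (j : ℤ)) ∧ δ ∈ G H (1 - (j : ℤ)) := by
    intro j
    induction j with
    | zero =>
      constructor
      · have : w = (u - 1) - (u0 - 1) := by rw [hw]; abel
        rw [this]; simpa using Submodule.sub_mem _ hu hu0
      · exact G_mono (by norm_num) (Submodule.sub_mem _ hCG (S.centG hC1))
    | succ j ih =>
      obtain ⟨iw, iδ⟩ := ih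
      obtain ⟨w0, a1, a2⟩ := G_lead iw
      obtain ⟨d0, b1, b2⟩ := G_lead iδ
      have c1 : ad X w0 + d0 = 0 := by
        refine G_zero (H := H) (a := 1 - (j : ℤ)) (b := -(j : ℤ)) ?_ (by omega) ?_
        · have : ad X w0 + d0 = (w * D - C * w - δ * (u0 - 1)) - (X * (w - w0) - (w - w0) * X) - (δ - d0) := by
            rw [← hid, ad_apply, ad_apply]; noncomm_ring
          rw [this]
          refine Submodule.sub_mem _ (Submodule.sub_mem _ (Submodule.sub_mem _ (Submodule.sub_mem _ ?_ ?_) ?_) (Submodule.sub_mem _ ?_ ?_)) ?_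
          · exact G_mul' iw hD (by omega)
          · exact G_mul' hCG iw (by omega)
          · exact G_mul' iδ hu0 (by omega)
          · exact G_mul' S.XG a2 (by omega)
          · exact G_mul' a2 S.XG (by omega)
          · exact G_mono (by omega) b2
        · rw [map_add, S.adj.hx', a1, b1, map_smul]; push_cast; module
      have c2 : ad Y d0 = 0 := by
        refine G_zero (H := H) (a := -1 - (j : ℤ)) (b := -2 - (j : ℤ)) ?_ (by omega) ?_
        · have : ad Y d0 = -(Y * (δ - d0) - (δ - d0) * Y) := by
            rw [← ad_apply, map_sub, hδY]; abel
          rw [this]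
          exact Submodule.neg_mem _ (Submodule.sub_mem _ (G_mul' S.YG b2 (by omega)) (G_mul' b2 S.YG (by omega)))
        · rw [S.adj.hy', b1, map_smul]; push_cast; module
      have c3 : d0 = ad X (-w0) := by
        rw [map_neg]; exact eq_neg_of_add_eq_zero_right c1
      have c4 : d0 = 0 := by
        have := I.xrx (-w0)
        rw [← c3, I.rker c2, map_zero] at this
        exact this.symm
      have c5 : ad X w0 = 0 := by rw [c4, add_zero] at c1; exact c1
      have c6 : w0 = 0 := by
        refine S.adj.neg (μ := ((-1 - (j : ℤ) : ℤ) : ℝ)) ?_ a1 (by rw [c5, map_zero])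
        have : -1 - (j : ℤ) < 0 := by omega
        exact_mod_cast this
      rw [c6, sub_zero] at a2
      rw [c4, sub_zero] at b2
      exact ⟨G_mono (by push_cast; omega) a2, G_mono (by push_cast; omega) b2⟩
  obtain ⟨N, hN⟩ := G_bot (H := H)
  have h5 := (key (N + 1)).2
  have h6 := G_mono (H := H) (b := -(N : ℤ)) (by push_cast; omega) h5
  rw [hN] at h6
  exact sub_eq_zero.mp ((Submodule.mem_bot ℝ).mp h6)

end Core
end Slice

namespace Slice

section Final
set_option linter.unusedSectionVars false
variable {E : Type*} [AddCommGroup E] [Module ℝ E] [FiniteDimensional ℝ E]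

open Module

lemma P_eig (M : Module.End ℝ E) (e : ℕ → ℝ) (μ : ℝ) (v : E) (hv : M v = μ • v) (k : ℕ) :
    P M e k v = (∏ i ∈ Finset.range k, (μ - e i)) • v := by
  induction k with
  | zero => simp [P]
  | succ k ih =>
    rw [P, Module.End.mul_apply, ih, Finset.prod_range_succ, map_smul, LinearMap.sub_apply, hv,
      LinearMap.smul_apply, Module.End.one_apply, ← sub_smul, smul_smul]

lemma ker_mul_le (A B : Module.End ℝ E) :
    finrank ℝ (LinearMap.ker (A * B)) ≤ finrank ℝ (LinearMap.ker A) + finrank ℝ (LinearMap.ker B) := by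
  have h := LinearMap.finrank_range_add_finrank_ker (B.domRestrict (LinearMap.ker (A * B)))
  have h1 : finrank ℝ (LinearMap.range (B.domRestrict (LinearMap.ker (A * B))))
      ≤ finrank ℝ (LinearMap.ker A) := by
    apply Submodule.finrank_mono
    rintro _ ⟨x, rfl⟩
    exact x.2
  have h2 : finrank ℝ (LinearMap.ker (B.domRestrict (LinearMap.ker (A * B))))
      ≤ finrank ℝ (LinearMap.ker B) := by
    have hi : Function.Injective ((LinearMap.ker (A * B)).subtype.comp
        (LinearMap.ker (B.domRestrict (LinearMap.ker (A * B)))).subtype) :=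
      (Subtype.val_injective).comp Subtype.val_injective
    rw [← LinearMap.finrank_range_of_inj hi]
    apply Submodule.finrank_mono
    rintro _ ⟨x, rfl⟩
    exact x.2
  omega

lemma card_lt {n r : ℕ} (q : Fin r → ℕ) (c : Fin n → Fin r)
    (hc : ∀ i, (Finset.univ.filter fun j => c j = i).card = q i) (σ : Equiv.Perm (Fin r)) (k : ℕ) :
    Fintype.card {j : Fin n // ((σ.symm (c j) : Fin r) : ℕ) < k} =
      ∑ i ∈ Finset.univ.filter (fun i : Fin r => (i : ℕ) < k), q (σ i) := by
  rw [Fintype.card_subtype, Finset.card_eq_sum_card_fiberwise (f := fun j => σ.symm (c j))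
    (t := Finset.univ.filter (fun i : Fin r => (i : ℕ) < k)) (by intro j; simp)]
  refine Finset.sum_congr rfl fun i hi => ?_
  rw [← hc, Finset.filter_filter]
  congr 1
  ext j
  simp only [Finset.mem_filter, Finset.mem_univ, true_and] at hi ⊢
  rw [Equiv.symm_apply_eq]
  constructor
  · exact fun h => h.2
  · intro h
    refine ⟨?_, h⟩
    rw [h]; simpa using hi

/-- the eigenvalue sequence -/
noncomputable def es {r : ℕ} (e : Fin r → ℝ) (σ : Equiv.Perm (Fin r)) : ℕ → ℝ :=
  fun i => if h : i < r then e (σ ⟨i, h⟩) else 0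

lemma ker_lower {n r : ℕ} (q : Fin r → ℕ) (c : Fin n → Fin r)
    (hc : ∀ i, (Finset.univ.filter fun j => c j = i).card = q i) (σ : Equiv.Perm (Fin r))
    (e : Fin r → ℝ) (M : Module.End ℝ E) (v : Fin n → E) (hv : LinearIndependent ℝ v)
    (hM : ∀ j, M (v j) = e (c j) • v j) (k : ℕ) :
    ∑ i ∈ Finset.univ.filter (fun i : Fin r => (i : ℕ) < k), q (σ i) ≤
      finrank ℝ (LinearMap.ker (P M (es e σ) k)) := by
  rw [← card_lt q c hc σ k]
  have hm : ∀ j : {j : Fin n // ((σ.symm (c j) : Fin r) : ℕ) < k},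
      v j ∈ LinearMap.ker (P M (es e σ) k) := by
    intro j
    rw [LinearMap.mem_ker, P_eig M _ _ _ (hM j)]
    rw [Finset.prod_eq_zero (Finset.mem_range.2 j.2), zero_smul]
    simp [es]
  have hl : LinearIndependent ℝ (fun j : {j : Fin n // ((σ.symm (c j) : Fin r) : ℕ) < k} =>
      (⟨v j, hm j⟩ : LinearMap.ker (P M (es e σ) k))) := by
    apply LinearIndependent.of_comp (LinearMap.ker (P M (es e σ) k)).subtype
    exact hv.comp _ Subtype.val_injective
  exact hl.fintype_card_le_finrank

lemma eig_lower {n r : ℕ} (q : Fin r → ℕ) (hr : r ≤ n) (σ : Equiv.Perm (Fin r))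
    (e : Fin r → ℝ) (M : Module.End ℝ E)
    (hk : ∀ k ≤ n, finrank ℝ (LinearMap.ker (P M (es e σ) k)) =
      ∑ i ∈ Finset.univ.filter (fun i : Fin r => (i : ℕ) < k), q (σ i)) (i : Fin r) :
    q i ≤ finrank ℝ (M.eigenspace (e i)) := by
  obtain ⟨i, rfl⟩ := σ.surjective i
  have h1 := hk i (by omega)
  have h2 := hk (i + 1) (by omega)
  have h3 := ker_mul_le (M - es e σ i • 1) (P M (es e σ) i)
  rw [P] at h2
  have h4 : (Finset.univ.filter (fun j : Fin r => (j : ℕ) < i + 1)) =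
      insert i (Finset.univ.filter (fun j : Fin r => (j : ℕ) < i)) := by
    ext j; simp [Fin.ext_iff]; omega
  rw [h4, Finset.sum_insert (by simp)] at h2
  have h5 : LinearMap.ker (M - es e σ i • 1) = M.eigenspace (e (σ i)) := by
    rw [Module.End.eigenspace_def]
    simp [es]
  rw [h5] at h3
  omega

lemma exists_eigvecs {n r : ℕ} (q : Fin r → ℕ) (c : Fin n → Fin r)
    (hc : ∀ i, (Finset.univ.filter fun j => c j = i).card = q i)
    (e : Fin r → ℝ) (he : Function.Injective e) (M : Module.End ℝ E)
    (hq : ∀ i, q i ≤ finrank ℝ (M.eigenspace (e i))) :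
    ∃ v : Fin n → E, LinearIndependent ℝ v ∧ ∀ j, M (v j) = e (c j) • v j := by
  have h1 : ∀ i, ∃ w : {j // c j = i} → M.eigenspace (e i), LinearIndependent ℝ w := by
    intro i
    obtain ⟨w, hw⟩ := exists_linearIndependent_of_le_finrank (hq i)
    have hcard : Fintype.card {j // c j = i} = Fintype.card (Fin (q i)) := by
      rw [Fintype.card_subtype, hc, Fintype.card_fin]
    exact ⟨w ∘ Fintype.equivOfCardEq hcard, hw.comp _ (Equiv.injective _)⟩
  choose w hw using h1
  refine ⟨fun j => (w (c j) ⟨j, rfl⟩ : E), ?_, fun j => ?_⟩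
  · rw [Fintype.linearIndependent_iff]
    intro a ha
    have hind := (M.eigenspaces_iSupIndep).comp he
    rw [iSupIndep_iff_finsetSum_eq_zero_imp_eq_zero] at hind
    have hz := hind Finset.univ
      (fun i => ((∑ j : {j // c j = i}, a j • w i j : M.eigenspace (e i)) : E))
      (fun i _ => Submodule.coe_mem _) (by
        rw [← ha, ← Fintype.sum_fiberwise c]
        refine Finset.sum_congr rfl fun i _ => ?_
        rw [Submodule.coe_sum]
        refine Finset.sum_congr rfl fun j _ => ?_
        obtain ⟨j, rfl⟩ := j
        rfl)
    intro j
    have h2 := hz (c j) (Finset.mem_univ _)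
    have h3 := (Fintype.linearIndependent_iff.1 (hw (c j))) (fun j => a j)
      (by exact_mod_cast h2)
    exact h3 ⟨j, rfl⟩
  · exact Module.End.mem_eigenspace_iff.1 (w (c j) ⟨j, rfl⟩).2

end Final

section Mat
open Module Matrix
variable {n : ℕ}

/-- matrices as endomorphisms -/
noncomputable abbrev tl : Matrix (Fin n) (Fin n) ℝ ≃ₐ[ℝ] Module.End ℝ (Fin n → ℝ) :=
  Matrix.toLinAlgEquiv'

lemma cols_of_eq (M G : Matrix (Fin n) (Fin n) ℝ) (d : Fin n → ℝ)
    (h : M * G = G * Matrix.diagonal d) (j : Fin n) : tl M (G.col j) = d j • G.col j := by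
  rw [Matrix.toLinAlgEquiv'_apply]
  ext i
  have := congrFun (congrFun h i) j
  rw [Matrix.mul_diagonal, Matrix.mul_apply] at this
  simpa [Matrix.mulVec, dotProduct, mul_comm] using this

lemma eq_of_cols (M G : Matrix (Fin n) (Fin n) ℝ) (d : Fin n → ℝ)
    (h : ∀ j, tl M (G.col j) = d j • G.col j) : M * G = G * Matrix.diagonal d := by
  ext i j
  have := congrFun (h j) i
  rw [Matrix.toLinAlgEquiv'_apply] at this
  rw [Matrix.mul_diagonal, Matrix.mul_apply]
  simpa [Matrix.mulVec, dotProduct, mul_comm] using this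

end Mat
end Slice

open Slice Module in
theorem main_thm
    {n r : ℕ} (hn : 1 ≤ n)
    (q : Fin r → ℕ) (hq : ∀ i, 0 < q i) (hsum : ∑ i, q i = n)
    (ν X H Y : Matrix (Fin n) (Fin n) ℝ)
    (hν : ∃ (g : GL (Fin n) ℝ) (e : Fin r → ℝ) (c : Fin n → Fin r),
        Function.Injective e ∧
        (∀ i, (Finset.univ.filter fun j => c j = i).card = q i) ∧
        ν = (g : Matrix (Fin n) (Fin n) ℝ) * Matrix.diagonal (fun j => e (c j)) *
              (↑g⁻¹ : Matrix (Fin n) (Fin n) ℝ))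
    (hX0 : X ≠ 0)
    (hHX : H * X - X * H = (2 : ℝ) • X)
    (hHY : H * Y - Y * H = (-2 : ℝ) • Y)
    (hXY : X * Y - Y * X = H)
    (σ : Equiv.Perm (Fin r)) (hσ : Antitone fun i => q (σ i))
    (hker : ∀ k : ℕ, k ≤ n →
        Module.finrank ℝ (LinearMap.ker (Matrix.mulVecLin (X ^ k)))
          = ∑ i ∈ Finset.univ.filter (fun i : Fin r => (i : ℕ) < k), q (σ i)) :
    ∃! M : Matrix (Fin n) (Fin n) ℝ,
      M ∈ ({M | ∃ g : GL (Fin n) ℝ,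
              M = (g : Matrix (Fin n) (Fin n) ℝ) * ν * (↑g⁻¹ : Matrix (Fin n) (Fin n) ℝ)} ∩
            {M | ∃ C, C * Y = Y * C ∧ M = X + C} : Set (Matrix (Fin n) (Fin n) ℝ)) := by
  obtain ⟨g, e, c, he, hc, rfl⟩ := hν
  have S : Sl2 (tl X) (tl H) (tl Y) := by
    refine ⟨?_, ?_, ?_⟩
    · rw [← map_mul, ← map_mul, ← map_smul, ← map_add, ← hHX]; congr 1; abel
    · rw [← map_mul, ← map_mul, ← map_smul, ← map_sub]; congr 1
      rw [eq_sub_iff_add_eq, ← sub_eq_zero]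
      have := sub_eq_zero.2 hHY
      rw [← this, neg_smul]; abel
    · rw [← map_mul, ← map_mul, ← map_add]; congr 1; rw [← hXY]; abel
  have hr : r ≤ n := by
    rw [← hsum]
    calc r = ∑ i : Fin r, 1 := by simp
      _ ≤ _ := Finset.sum_le_sum fun i _ => hq i
  have hkt : ∀ k ≤ n, finrank ℝ (LinearMap.ker ((tl X) ^ k)) =
      ∑ i ∈ Finset.univ.filter (fun i : Fin r => (i : ℕ) < k), q (σ i) := by
    intro k hk
    rw [← hker k hk, ← map_pow]
    rfl
  have hkle : ∀ k, finrank ℝ (LinearMap.ker ((tl X) ^ k)) ≤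
      ∑ i ∈ Finset.univ.filter (fun i : Fin r => (i : ℕ) < k), q (σ i) := by
    intro k
    rcases le_or_gt k n with hk | hk
    · exact (hkt k hk).le
    · rw [Finset.filter_true_of_mem (fun i _ => by omega), Equiv.sum_comp σ q, hsum]
      exact (Submodule.finrank_le _).trans (by simp)
  obtain ⟨D, hDG, hD⟩ := S.exD (es e σ)
  have hM0 : ∀ k ≤ n, finrank ℝ (LinearMap.ker (P (tl X + D) (es e σ) k)) =
      ∑ i ∈ Finset.univ.filter (fun i : Fin r => (i : ℕ) < k), q (σ i) := fun k hk => by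
    rw [S.finrank_P_M0 hDG hD k, hkt k hk]
  obtain ⟨v, hvl, hv⟩ := exists_eigvecs q c hc e he (tl X + D) (eig_lower q hr σ e _ hM0)
  obtain ⟨u0, C1, hu0, hC1, h01⟩ := S.exists_slice hDG
  obtain ⟨s0, hs1, hs2, -⟩ := G_inv hu0
  rw [add_sub_cancel] at hs1 hs2
  -- matrix forms
  obtain ⟨U, rfl⟩ := (tl (n := n)).surjective u0
  obtain ⟨U', rfl⟩ := (tl (n := n)).surjective s0
  obtain ⟨C, rfl⟩ := (tl (n := n)).surjective C1
  obtain ⟨D, rfl⟩ := (tl (n := n)).surjective D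
  have hUU' : U * U' = 1 := tl.injective (by rw [map_mul, hs2, map_one])
  have hU'U : U' * U = 1 := tl.injective (by rw [map_mul, hs1, map_one])
  have hUM : U * (X + D) = (X + C) * U := tl.injective (by simpa using h01)
  have hCY : C * Y = Y * C := tl.injective (by simpa using hC1)
  let u : GL (Fin n) ℝ := ⟨U, U', hUU', hU'U⟩
  let Gm : Matrix (Fin n) (Fin n) ℝ := Matrix.of fun i j => v j i
  have hGu : IsUnit Gm := Matrix.linearIndependent_cols_iff_isUnit.1 hvl
  obtain ⟨gm, hgm⟩ := hGu
  have hGM : (X + D) * Gm = Gm * Matrix.diagonal (fun j => e (c j)) := by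
    apply eq_of_cols
    intro j
    rw [map_add]
    exact hv j
  have hX1 : X + D = (gm : Matrix (Fin n) (Fin n) ℝ) * Matrix.diagonal (fun j => e (c j)) *
      (↑gm⁻¹ : Matrix (Fin n) (Fin n) ℝ) := by
    rw [Units.eq_mul_inv_iff_mul_eq, hgm, hGM]
  have hX2 : X + C = (u : Matrix (Fin n) (Fin n) ℝ) * (X + D) *
      (↑u⁻¹ : Matrix (Fin n) (Fin n) ℝ) := by
    rw [Units.eq_mul_inv_iff_mul_eq]; exact hUM.symm
  refine ⟨X + C, ⟨⟨u * gm * g⁻¹, ?_⟩, C, hCY, rfl⟩, ?_⟩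
  · rw [hX2, hX1]
    simp only [mul_inv_rev, inv_inv, Units.val_mul, mul_assoc, Units.inv_mul_cancel_left]
  · rintro _ ⟨⟨k, hk⟩, C', hC', rfl⟩
    have hC'' : tl C' * tl Y = tl Y * tl C' := by rw [← map_mul, hC', map_mul]
    have hw : (X + C') * (↑(k * g) : Matrix (Fin n) (Fin n) ℝ) =
        (↑(k * g) : Matrix (Fin n) (Fin n) ℝ) * Matrix.diagonal (fun j => e (c j)) := by
      rw [hk]
      simp only [Units.val_mul, mul_assoc, Units.inv_mul_cancel_left, Units.inv_mul, mul_one]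
    have hlow := ker_lower q c hc σ e (tl (X + C')) _
      (Matrix.linearIndependent_cols_iff_isUnit.2 (k * g).isUnit) (cols_of_eq _ _ _ hw)
    obtain ⟨u', hu', h'⟩ := S.intertwine (M := tl (X + C')) hD
      (by rw [map_add, add_sub_cancel_left]; exact S.centG hC'')
      (fun k => (hkle k).trans (hlow k))
    rw [map_add] at h'
    have := S.endgame hDG hu' hu0 hC'' hC1 h' h01
    rw [tl.injective this]


/-- Counting form (via Rao's lemma) of the `GL(n,ℝ)` limit formula
`lim_{t→0⁺} O_{tξ} = O_𝓛` (Proposition 4.7): if `ν` is diagonalizable over `ℝ` with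
exactly `r` distinct eigenvalues of multiplicities `q_1,…,q_r`, and `(X,H,Y)` is an
`sl₂`-triple with `dim ker X^k` equal to the sum of the `k` largest values among the
`q_i`, then `O_ν ∩ (X + Z(Y))` has exactly one element. -/
theorem orbit_inter_slice_unique_gl_real
    {n r : ℕ} (hn : 1 ≤ n)
    (q : Fin r → ℕ) (hq : ∀ i, 0 < q i) (hsum : ∑ i, q i = n)
    (ν X H Y : Matrix (Fin n) (Fin n) ℝ)
    -- `ν` is diagonalizable over `ℝ` with exactly `r` distinct eigenvalues of
    -- multiplicities `q_1, …, q_r`: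
    (hν : ∃ (g : GL (Fin n) ℝ) (e : Fin r → ℝ) (c : Fin n → Fin r),
        Function.Injective e ∧
        (∀ i, (Finset.univ.filter fun j => c j = i).card = q i) ∧
        ν = (g : Matrix (Fin n) (Fin n) ℝ) * Matrix.diagonal (fun j => e (c j)) *
              (↑g⁻¹ : Matrix (Fin n) (Fin n) ℝ))
    -- `(X, H, Y)` is an `sl₂`-triple:
    (hX0 : X ≠ 0)
    (hHX : H * X - X * H = (2 : ℝ) • X)
    (hHY : H * Y - Y * H = (-2 : ℝ) • Y)
    (hXY : X * Y - Y * X = H)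
    -- `dim ker X^k` is the sum of the `k` largest values among `q_1, …, q_r`
    -- (expressed via a rearrangement `σ` of the `q_i` into decreasing order):
    (σ : Equiv.Perm (Fin r)) (hσ : Antitone fun i => q (σ i))
    (hker : ∀ k : ℕ, k ≤ n →
        Module.finrank ℝ (LinearMap.ker (Matrix.mulVecLin (X ^ k)))
          = ∑ i ∈ Finset.univ.filter (fun i : Fin r => (i : ℕ) < k), q (σ i)) :
    ∃! M : Matrix (Fin n) (Fin n) ℝ,
      M ∈ ({M | ∃ g : GL (Fin n) ℝ,
              M = (g : Matrix (Fin n) (Fin n) ℝ) * ν * (↑g⁻¹ : Matrix (Fin n) (Fin n) ℝ)} ∩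
            {M | ∃ C, C * Y = Y * C ∧ M = X + C} : Set (Matrix (Fin n) (Fin n) ℝ)) := by
  exact main_thm hn q hq hsum ν X H Y hν hX0 hHX hHY hXY σ hσ hker
end

section
/- Let n ≥ 1 and let q_1, …, q_r be positive integers with q_1 + ⋯ + q_r = n. Partition the index set {1, …, n} into consecutive blocks B_1, …, B_r of sizes q_1, …, q_r, and let N be the ℝ-linear subspace of n×n real matrices M such that M_{ij} = 0 unless the block containing i is strictly earlier than the block containing j (block strictly upper triangular matrices). Then there exists a matrix X ∈ N such that: (a) for every integer k with 0 ≤ k ≤ n, the ℝ-dimension of the kernel of X^k equals the sum of the k largest values among q_1, …, q_r; (b) the set {M ∈ N : M = g X g⁻¹ for some g ∈ GL(n,ℝ)} is open and dense in N (with the subspace topology of N inside the matrix space); and (c) any X' ∈ N such that {M ∈ N : M = g X' g⁻¹ for some g ∈ GL(n,ℝ)} is dense in N satisfies X' = g X g⁻¹ for some g ∈ GL(n,ℝ). -/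
section
open Finset

/-- extension of injective maps -/
lemma ext_inj {A B : Type*} [AddCommGroup A] [Module ℝ A] [AddCommGroup B] [Module ℝ B]
    [FiniteDimensional ℝ A] [FiniteDimensional ℝ B] (A' : Submodule ℝ A) (f : A' →ₗ[ℝ] B)
    (hf : Function.Injective f) (hd : Module.finrank ℝ A ≤ Module.finrank ℝ B) :
    ∃ g : A →ₗ[ℝ] B, Function.Injective g ∧ ∀ x : A', g x = f x := by
  obtain ⟨C, hC⟩ := A'.exists_isCompl
  obtain ⟨C', hC'⟩ := (LinearMap.range f).exists_isCompl
  have h1 := Submodule.finrank_add_eq_of_isCompl hC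
  have h2 := Submodule.finrank_add_eq_of_isCompl hC'
  have h3 := LinearMap.finrank_range_of_inj hf
  have h4 : Module.finrank ℝ C ≤ Module.finrank ℝ C' := by omega
  obtain ⟨i, hi⟩ := finrank_le_iff_exists_linearMap.1 h4
  refine ⟨LinearMap.ofIsCompl hC f (C'.subtype ∘ₗ i), ?_, fun x => by simp⟩
  rw [injective_iff_map_eq_zero]
  intro a ha
  obtain ⟨x, y, hx, rfl⟩ : ∃ x : A', ∃ y : C, True ∧ (x : A) + y = a := by
    have : a ∈ A' ⊔ C := by rw [hC.sup_eq_top]; trivial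
    obtain ⟨x, hx, y, hy, h⟩ := Submodule.mem_sup.1 this
    exact ⟨⟨x, hx⟩, ⟨y, hy⟩, trivial, h⟩
  simp only [map_add, LinearMap.ofIsCompl_apply_left, LinearMap.ofIsCompl_apply_right,
    LinearMap.comp_apply, Submodule.subtype_apply] at ha
  have hz : f x = 0 := by
    have : f x ∈ LinearMap.range f ⊓ C' := by
      refine ⟨⟨x, rfl⟩, ?_⟩
      rw [eq_neg_of_add_eq_zero_left ha]
      exact C'.neg_mem (i y).2
    rwa [hC'.inf_eq_bot, Submodule.mem_bot] at this
  rw [hz, zero_add] at ha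
  have hx0 : x = 0 := hf (by rw [hz, map_zero])
  have hy0 : y = 0 := hi (by rw [map_zero]; exact Subtype.ext ha)
  simp [hx0, hy0]

/-- submodule version -/
lemma ext_inj' {V W : Type*} [AddCommGroup V] [Module ℝ V] [AddCommGroup W] [Module ℝ W]
    [FiniteDimensional ℝ V] [FiniteDimensional ℝ W] (A' A : Submodule ℝ V) (B : Submodule ℝ W)
    (hA : A' ≤ A) (e : V →ₗ[ℝ] W) (heB : ∀ x ∈ A', e x ∈ B) (he : ∀ x ∈ A', e x = 0 → x = 0)
    (hd : Module.finrank ℝ A ≤ Module.finrank ℝ B) :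
    ∃ g : V →ₗ[ℝ] W, (∀ x ∈ A, g x = 0 → x = 0) ∧ (∀ x ∈ A, g x ∈ B) ∧ ∀ x ∈ A', g x = e x := by
  have key : ∀ x : A'.comap A.subtype, e x ∈ B := fun x => heB _ x.2
  obtain ⟨g, hg, hg'⟩ := ext_inj (A'.comap A.subtype)
    (LinearMap.codRestrict B (e ∘ₗ A.subtype ∘ₗ (A'.comap A.subtype).subtype) key) (by
      rw [injective_iff_map_eq_zero]
      intro a ha
      have := he a a.2 (congrArg Subtype.val ha)
      exact Subtype.ext (Subtype.ext this)) hd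
  obtain ⟨G, hG⟩ := LinearMap.exists_extend (B.subtype ∘ₗ g)
  have hG' : ∀ x (hx : x ∈ A), G x = g ⟨x, hx⟩ := fun x hx => LinearMap.congr_fun hG ⟨x, hx⟩
  refine ⟨G, fun x hx h => ?_, fun x hx => ?_, fun x hx => ?_⟩
  · rw [hG' x hx] at h
    have : (⟨x, hx⟩ : A) = 0 := hg (by rw [map_zero]; exact Subtype.ext h)
    exact congrArg Subtype.val this
  · rw [hG' x hx]; exact (g _).2
  · rw [hG' x (hA hx)]
    exact congrArg Subtype.val (hg' ⟨⟨x, hA hx⟩, hx⟩)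

lemma glue {V W : Type*} [AddCommGroup V] [Module ℝ V] [AddCommGroup W] [Module ℝ W]
    (A B : Submodule ℝ V) (f g : V →ₗ[ℝ] W) (h : ∀ x ∈ A, x ∈ B → f x = g x) :
    ∃ k : V →ₗ[ℝ] W, (∀ x ∈ A, k x = f x) ∧ ∀ x ∈ B, k x = g x := by
  have hh : ∀ (x : (LinearPMap.mk A (f ∘ₗ A.subtype)).domain)
      (y : (LinearPMap.mk B (g ∘ₗ B.subtype)).domain), (x : V) = y →
      (LinearPMap.mk A (f ∘ₗ A.subtype)) x = (LinearPMap.mk B (g ∘ₗ B.subtype)) y := by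
    rintro ⟨x, hx⟩ ⟨y, hy⟩ hxy
    simp only at hxy
    subst hxy
    exact h x hx hy
  obtain ⟨k, hk⟩ := LinearMap.exists_extend (LinearPMap.sup _ _ hh).toFun
  refine ⟨k, fun x hx => ?_, fun x hx => ?_⟩
  · have h1 := LinearMap.congr_fun hk ⟨x, Submodule.mem_sup_left hx⟩
    have h2 := (LinearPMap.left_le_sup _ _ hh).2 (x := ⟨x, hx⟩)
      (y := ⟨x, Submodule.mem_sup_left hx⟩) rfl
    exact h1.trans h2.symm
  · have h1 := LinearMap.congr_fun hk ⟨x, Submodule.mem_sup_right hx⟩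
    have h2 := (LinearPMap.right_le_sup _ _ hh).2 (x := ⟨x, hx⟩)
      (y := ⟨x, Submodule.mem_sup_right hx⟩) rfl
    exact h1.trans h2.symm

lemma section_lem {W : Type*} [AddCommGroup W] [Module ℝ W]
    (S : W →ₗ[ℝ] W) (R : Submodule ℝ W) :
    ∃ s : W →ₗ[ℝ] W, ∀ y ∈ R.map S, s y ∈ R ∧ S (s y) = y := by
  let T : R →ₗ[ℝ] R.map S := S.restrict (fun x hx => Submodule.mem_map_of_mem hx)
  have hT : LinearMap.range T = ⊤ := by
    rw [LinearMap.range_eq_top]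
    rintro ⟨_, x, hx, rfl⟩
    exact ⟨⟨x, hx⟩, rfl⟩
  obtain ⟨u, hu⟩ := T.exists_rightInverse_of_surjective hT
  obtain ⟨s, hs⟩ := LinearMap.exists_extend (R.subtype ∘ₗ u)
  refine ⟨s, fun y hy => ?_⟩
  have h1 : s y = u ⟨y, hy⟩ := LinearMap.congr_fun hs ⟨y, hy⟩
  rw [h1]
  exact ⟨(u _).2, congrArg Subtype.val (LinearMap.congr_fun hu ⟨y, hy⟩)⟩

lemma range_pow_succ' {V : Type*} [AddCommGroup V] [Module ℝ V] (T : Module.End ℝ V) (j : ℕ) :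
    LinearMap.range (T ^ (j+1)) = (LinearMap.range (T ^ j)).map T := by
  rw [pow_succ', Module.End.mul_eq_comp, LinearMap.range_comp]

lemma finrank_ker_inf {V : Type*} [AddCommGroup V] [Module ℝ V] [FiniteDimensional ℝ V]
    (T : Module.End ℝ V) (j : ℕ) :
    Module.finrank ℝ (LinearMap.range (T ^ (j+1))) +
      Module.finrank ℝ (LinearMap.ker T ⊓ LinearMap.range (T ^ j) : Submodule ℝ V) =
      Module.finrank ℝ (LinearMap.range (T ^ j)) := by
  rw [range_pow_succ']
  have := LinearMap.finrank_range_add_finrank_ker (T.domRestrict (LinearMap.range (T ^ j)))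
  rw [LinearMap.range_domRestrict, LinearMap.ker_domRestrict] at this
  rw [← this]
  congr 1
  rw [inf_comm, ← Submodule.map_comap_subtype]
  exact Submodule.finrank_map_subtype_eq _ _

lemma intertwine {V W : Type*} [AddCommGroup V] [Module ℝ V] [AddCommGroup W] [Module ℝ W]
    [FiniteDimensional ℝ V] [FiniteDimensional ℝ W] (T : Module.End ℝ V) (S : Module.End ℝ W)
    (n : ℕ) (hT : T ^ n = 0)
    (hd : ∀ j < n, Module.finrank ℝ (LinearMap.ker T ⊓ LinearMap.range (T ^ j) : Submodule ℝ V) ≤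
      Module.finrank ℝ (LinearMap.ker S ⊓ LinearMap.range (S ^ j) : Submodule ℝ W)) :
    ∃ e : V →ₗ[ℝ] W, Function.Injective e ∧ ∀ x, S (e x) = e (T x) := by
  have main : ∀ m ≤ n, ∃ e : V →ₗ[ℝ] W, ∀ x ∈ LinearMap.range (T ^ (n - m)),
      e x ∈ LinearMap.range (S ^ (n - m)) ∧ S (e x) = e (T x) ∧
      (T x = 0 → e x = 0 → x = 0) := by
    intro m
    induction m with
    | zero =>
      intro _
      refine ⟨0, fun x hx => ?_⟩
      simp [hT] at hx
      simp [hx]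
    | succ m ih =>
      intro hm
      obtain ⟨e, he⟩ := ih (by omega)
      obtain ⟨j, hj⟩ : ∃ j, j = n - (m+1) := ⟨_, rfl⟩
      have hj1 : n - m = j + 1 := by omega
      rw [hj1] at he
      rw [← hj]
      specialize hd j (by omega)
      have hR : LinearMap.range (T ^ (j+1)) ≤ LinearMap.range (T ^ j) := by
        rw [pow_succ]; exact LinearMap.range_comp_le_range _ _
      have hRS : LinearMap.range (S ^ (j+1)) ≤ LinearMap.range (S ^ j) := by
        rw [pow_succ]; exact LinearMap.range_comp_le_range _ _
      have hTR : ∀ x ∈ LinearMap.range (T ^ j), T x ∈ LinearMap.range (T ^ (j+1)) := by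
        intro x hx; rw [range_pow_succ']; exact Submodule.mem_map_of_mem hx
      obtain ⟨e1, h1, h1B, h1e⟩ := ext_inj' (LinearMap.ker T ⊓ LinearMap.range (T ^ (j+1)))
        (LinearMap.ker T ⊓ LinearMap.range (T ^ j)) (LinearMap.ker S ⊓ LinearMap.range (S ^ j))
        (inf_le_inf_left _ hR) e (by
          rintro x ⟨hx, hx'⟩
          obtain ⟨a, b, -⟩ := he x hx'
          refine ⟨?_, hRS a⟩
          have hx0 : T x = 0 := hx
          have : S (e x) = 0 := by rw [b, hx0, map_zero]
          exact this) (by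
          rintro x ⟨hx, hx'⟩ h0
          exact (he x hx').2.2 hx h0) hd
      obtain ⟨e2, h2, h2'⟩ := glue (LinearMap.range (T ^ (j+1)))
        (LinearMap.ker T ⊓ LinearMap.range (T ^ j)) e e1
        (fun x hx hx' => (h1e x ⟨hx'.1, hx⟩).symm)
      obtain ⟨s, hs⟩ := section_lem S (LinearMap.range (S ^ j))
      rw [← range_pow_succ'] at hs
      set U := LinearMap.range (T ^ (j+1)) ⊔ (LinearMap.ker T ⊓ LinearMap.range (T ^ j)) with hU
      have hUR : U ≤ LinearMap.range (T ^ j) := sup_le hR inf_le_right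
      obtain ⟨π, hπ⟩ := U.subtype.exists_leftInverse_of_injective (by simp)
      have hπ' : ∀ x (hx : x ∈ U), π x = ⟨x, hx⟩ := fun x hx => LinearMap.congr_fun hπ ⟨x, hx⟩
      have hU2 : ∀ u ∈ U, e2 u ∈ LinearMap.range (S ^ j) ∧ S (e2 u) = e (T u) := by
        intro u hu
        obtain ⟨a, ha, b, hb, rfl⟩ := Submodule.mem_sup.1 hu
        rw [map_add, h2 a ha, h2' b hb, map_add, (he a ha).2.1, (h1B b hb).1, map_add,
          LinearMap.mem_ker.1 hb.1, add_zero, add_zero]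
        exact ⟨add_mem (hRS (he a ha).1) (h1B b hb).2, rfl⟩
      let e3 : V →ₗ[ℝ] W := e2 ∘ₗ U.subtype ∘ₗ π +
        s ∘ₗ e ∘ₗ T ∘ₗ (LinearMap.id - U.subtype ∘ₗ π)
      have h3 : ∀ x, e3 x = e2 (π x) + s (e (T (x - π x))) := fun x => rfl
      have h3U : ∀ x ∈ U, e3 x = e2 x := by
        intro x hx; rw [h3, hπ' x hx]; simp
      refine ⟨e3, fun x hx => ?_⟩
      have hd : x - π x ∈ LinearMap.range (T ^ j) := sub_mem hx (hUR (π x).2)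
      have hs' := hs _ (he _ (hTR _ hd)).1
      refine ⟨?_, ?_, ?_⟩
      · rw [h3]; exact add_mem (hU2 _ (π x).2).1 hs'.1
      · rw [h3U _ (Submodule.mem_sup_left (hTR x hx)), h2 _ (hTR x hx), h3, map_add, hs'.2,
          (hU2 _ (π x).2).2, ← map_add, ← map_add]
        simp
      · intro hx0 he0
        have hx1 : x ∈ LinearMap.ker T ⊓ LinearMap.range (T ^ j) := ⟨hx0, hx⟩
        rw [h3U _ (Submodule.mem_sup_right hx1), h2' _ hx1] at he0
        exact h1 x hx1 he0
  obtain ⟨e, he⟩ := main n le_rfl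
  simp only [Nat.sub_self, pow_zero] at he
  have he' := fun x => he x ⟨x, rfl⟩
  refine ⟨e, ?_, fun x => (he' x).2.1⟩
  rw [injective_iff_map_eq_zero]
  have : ∀ k x, (T ^ k) x = 0 → e x = 0 → x = 0 := by
    intro k
    induction k with
    | zero => intro x h _; simpa using h
    | succ k ih =>
      intro x h h'
      have : T x = 0 := by
        apply ih
        · rwa [pow_succ, Module.End.mul_apply] at h
        · rw [← (he' x).2.1, h', map_zero]
      exact (he' x).2.2 this h'
  intro x hx
  exact this n x (by simp [hT]) hx
lemma ker_lower_aux {V : Type*} [AddCommGroup V] [Module ℝ V] [FiniteDimensional ℝ V]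
    (T : V →ₗ[ℝ] V) (A B K : Submodule ℝ V) (hAB : ∀ x ∈ A, T x ∈ B) (hK : K ≤ B) :
    Module.finrank ℝ A + Module.finrank ℝ K ≤
      Module.finrank ℝ (A ⊓ K.comap T : Submodule ℝ V) + Module.finrank ℝ B := by
  let φ : A →ₗ[ℝ] (V ⧸ K) := K.mkQ ∘ₗ T ∘ₗ A.subtype
  have h1 := LinearMap.finrank_range_add_finrank_ker φ
  have h2 : Module.finrank ℝ (LinearMap.ker φ) =
      Module.finrank ℝ (A ⊓ K.comap T : Submodule ℝ V) := by
    rw [← Submodule.map_comap_subtype, Submodule.finrank_map_subtype_eq]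
    have : LinearMap.ker φ = (K.comap T).comap A.subtype := by
      ext x
      simp [φ]
    rw [this]
  have h3 : Module.finrank ℝ (LinearMap.range φ) ≤ Module.finrank ℝ (B.map K.mkQ) := by
    apply Submodule.finrank_mono
    rintro _ ⟨x, rfl⟩
    exact ⟨T x, hAB x x.2, rfl⟩
  have h4 := LinearMap.finrank_range_add_finrank_ker (K.mkQ.domRestrict B)
  rw [LinearMap.range_domRestrict, LinearMap.ker_domRestrict, Submodule.ker_mkQ,
    ← Submodule.finrank_map_subtype_eq, Submodule.map_comap_subtype, inf_eq_right.2 hK] at h4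
  omega

/-- Kernel lower bound. -/
lemma ker_lower {n r : ℕ} (q : Fin r → ℕ) (c : Fin n → Fin r)
    (hfib : ∀ i, (Finset.univ.filter fun j => c j = i).card = q i)
    (M : Matrix (Fin n) (Fin n) ℝ) (hM : ∀ i j, ¬ c i < c j → M i j = 0)
    (k : ℕ) (S : Finset (Fin r)) (hS : S.card ≤ k) :
    ∑ i ∈ S, q i ≤ Module.finrank ℝ (LinearMap.ker (Matrix.mulVecLin (M ^ k))) := by
  classical
  let V : ℕ → Submodule ℝ (Fin n → ℝ) := fun a =>
    Submodule.span ℝ (((univ.filter fun j => (c j : ℕ) < a).image (Pi.basisFun ℝ (Fin n)) : Finset _) : Set (Fin n → ℝ))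
  have hVmono : ∀ a, V a ≤ V (a+1) := by
    intro a
    apply Submodule.span_mono
    intro x hx
    simp only [coe_image, Set.mem_image, mem_coe, mem_filter, mem_univ, true_and] at hx ⊢
    obtain ⟨j, hj, rfl⟩ := hx
    exact ⟨j, by omega, rfl⟩
  have hVdim : ∀ a, Module.finrank ℝ (V a) = (univ.filter fun j => (c j : ℕ) < a).card := by
    intro a
    have hinj := (Pi.basisFun ℝ (Fin n)).injective
    rw [← card_image_of_injective _ hinj]
    apply finrank_span_finset_eq_card
    have := (Pi.basisFun ℝ (Fin n)).linearIndependent.linearIndepOn_id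
    refine this.mono ?_
    intro x hx
    simp only [coe_image, Set.mem_image] at hx
    obtain ⟨j, _, rfl⟩ := hx
    exact ⟨j, rfl⟩
  have hMV : ∀ a, ∀ x ∈ V (a+1), M.mulVecLin x ∈ V a := by
    intro a x hx
    have : (V (a+1)).map M.mulVecLin ≤ V a := by
      rw [Submodule.map_span_le]
      intro x hx
      simp only [coe_image, Set.mem_image, mem_coe, mem_filter, mem_univ, true_and] at hx
      obtain ⟨j, hj, rfl⟩ := hx
      have : M.mulVecLin (Pi.basisFun ℝ (Fin n) j) = ∑ i, M i j • Pi.basisFun ℝ (Fin n) i := by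
        ext l
        simp [Pi.single_apply]
      rw [this]
      apply Submodule.sum_mem
      intro i _
      by_cases hij : c i < c j
      · apply Submodule.smul_mem
        apply Submodule.subset_span
        simp only [coe_image, Set.mem_image, mem_coe, mem_filter, mem_univ, true_and]
        exact ⟨i, by have := Fin.lt_def.1 hij; omega, rfl⟩
      · rw [hM i j hij, zero_smul]; exact zero_mem _
    exact this ⟨x, hx, rfl⟩
  have main : ∀ a : ℕ, ∀ k, ∀ S : Finset (Fin r), (∀ i ∈ S, (i : ℕ) < a) → S.card ≤ k →
      ∑ i ∈ S, q i ≤ Module.finrank ℝ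
        (V a ⊓ LinearMap.ker (Matrix.mulVecLin (M ^ k)) : Submodule ℝ (Fin n → ℝ)) := by
    intro a
    induction a with
    | zero =>
      intro k S h _
      have : S = ∅ := by
        rw [eq_empty_iff_forall_notMem]; intro i hi; exact absurd (h i hi) (by omega)
      simp [this]
    | succ a ih =>
      intro k S h hk
      by_cases hS : ∃ i ∈ S, (i : ℕ) = a
      · obtain ⟨i, hi, hia⟩ := hS
        rw [← add_sum_erase _ _ hi]
        have hcard := card_erase_add_one hi
        obtain ⟨k, rfl⟩ : ∃ k', k = k' + 1 := ⟨k - 1, by omega⟩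
        have h1 := ih k (S.erase i) (by
          intro j hj
          have h2 := h j (mem_of_mem_erase hj)
          have h3 : j ≠ i := ne_of_mem_erase hj
          have h4 : (j : ℕ) ≠ i := fun h => h3 (Fin.ext h)
          omega) (by omega)
        have h2 := ker_lower_aux M.mulVecLin (V (a+1)) (V a)
          (V a ⊓ LinearMap.ker (Matrix.mulVecLin (M ^ k))) (hMV a) inf_le_left
        have h3 : Module.finrank ℝ (V (a+1)) = q i + Module.finrank ℝ (V a) := by
          rw [hVdim, hVdim, ← hfib i, ← card_union_of_disjoint]
          · congr 1
            ext j
            simp only [mem_filter, mem_univ, true_and, mem_union, Fin.ext_iff]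
            omega
          · rw [disjoint_left]
            intro j
            simp only [mem_filter, mem_univ, true_and, Fin.ext_iff]
            omega
        have h4 : V (a+1) ⊓ (V a ⊓ LinearMap.ker (Matrix.mulVecLin (M ^ k))).comap M.mulVecLin ≤
            V (a+1) ⊓ LinearMap.ker (Matrix.mulVecLin (M ^ (k+1))) := by
          rintro x ⟨hx, hx'⟩
          refine ⟨hx, ?_⟩
          have : (M ^ k).mulVec (M.mulVec x) = 0 := hx'.2
          rw [Matrix.mulVec_mulVec, ← pow_succ] at this
          exact this
        have h5 := Submodule.finrank_mono h4
        omega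
      · push Not at hS
        refine (ih k S (fun i hi => ?_) hk).trans (Submodule.finrank_mono
          (inf_le_inf_right _ (hVmono a)))
        have := h i hi
        have := hS i hi
        omega
  exact (main r k S (fun i _ => i.2) hS).trans (Submodule.finrank_mono inf_le_right)

lemma exists_pred {r : ℕ} (A : Finset (Fin r)) (i : Fin r) (h : 0 < (A.filter (· < i)).card) :
    ∃ i' ∈ A, i' < i ∧ (A.filter (· < i')).card + 1 = (A.filter (· < i)).card := by
  have hne := card_pos.1 h
  have hm := max'_mem _ hne
  have hmx := fun x hx => le_max' (A.filter (· < i)) x hx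
  set m := (A.filter (· < i)).max' hne
  rw [mem_filter] at hm
  refine ⟨m, hm.1, hm.2, ?_⟩
  have : A.filter (· < i) = insert m (A.filter (· < m)) := by
    ext x
    have := hmx x
    simp only [mem_filter, mem_insert] at this ⊢
    constructor
    · rintro ⟨h1, h2⟩
      rcases (this ⟨h1, h2⟩).lt_or_eq with h | h
      · exact Or.inr ⟨h1, h⟩
      · exact Or.inl h
    · rintro (rfl | ⟨h1, h2⟩)
      · exact hm
      · exact ⟨h1, h2.trans hm.2⟩
  rw [this, card_insert_of_notMem (by simp)]

lemma count_p {r : ℕ} (q : Fin r → ℕ) (σ : Equiv.Perm (Fin r)) (hσ : Antitone fun i => q (σ i))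
    (k p : ℕ) :
    (univ.filter fun i => p < q i ∧
      ((univ.filter fun i' => p < q i').filter (· < i)).card < k).card ≤
    (univ.filter fun i : Fin r => (i : ℕ) < k ∧ p < q (σ i)).card := by
  classical
  set A := univ.filter fun i' => p < q i' with hA
  set L := univ.filter fun i => p < q i ∧ (A.filter (· < i)).card < k with hL
  have hLA : L.card ≤ A.card := card_le_card (by intro i; simp +contextual [hL, hA])
  have hLk : L.card ≤ k := by
    rw [← card_range k]
    apply card_le_card_of_injOn (fun i => (A.filter (· < i)).card)
    · intro i hi
      simp [hL] at hi
      simpa using hi.2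
    · have key : ∀ i ∈ L, ∀ j, i < j → (A.filter (· < i)).card < (A.filter (· < j)).card := by
        intro i hi j hij
        apply card_lt_card
        rw [ssubset_iff_of_subset]
        · refine ⟨i, ?_, by simp⟩
          simp [hL] at hi
          simp [hA, hi.1, hij]
        · intro x hx
          simp only [mem_filter] at hx ⊢
          exact ⟨hx.1, hx.2.trans hij⟩
      intro i hi j hj hij
      simp only at hij
      rcases lt_trichotomy i j with h | h | h
      · have := key i hi j h; omega
      · exact h
      · have := key j hj i h; omega
  have hAcard : A.card = (univ.filter fun i => p < q (σ i)).card := by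
    symm
    apply card_bij (fun i _ => σ i)
    · intro i; simp [hA]
    · intro i _ j _ h; exact σ.injective h
    · intro j hj; exact ⟨σ.symm j, by simpa [hA] using hj, by simp⟩
  by_cases hall : k ≤ r ∧ ∀ i : Fin r, (i : ℕ) < k → p < q (σ i)
  · refine hLk.trans ?_
    obtain ⟨hkr, hall⟩ := hall
    have : k = (univ : Finset (Fin k)).card := by simp
    rw [this]
    apply card_le_card_of_injOn (fun i => Fin.castLE hkr i)
    · intro i _
      simp
      exact hall _ (by simp)
    · intro i _ j _ h; simpa using h
  · refine hLA.trans (hAcard.le.trans (card_le_card ?_))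
    intro i
    simp only [mem_filter, mem_univ, true_and]
    intro hi
    refine ⟨?_, hi⟩
    by_contra hik
    apply hall
    refine ⟨by omega, fun i' hi' => lt_of_lt_of_le hi (hσ (Fin.le_def.2 (by omega)))⟩

lemma exists_X {n r : ℕ} (q : Fin r → ℕ) (hsum : ∑ i, q i = n) (c : Fin n → Fin r)
    (hfib : ∀ i, (Finset.univ.filter fun j => c j = i).card = q i)
    (σ : Equiv.Perm (Fin r)) (hσ : Antitone fun i => q (σ i)) :
    ∃ X : Matrix (Fin n) (Fin n) ℝ, (∀ i j, ¬ c i < c j → X i j = 0) ∧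
      ∃ (J : ℕ → Finset (Fin n)) (g : ∀ k, J k → Fin n), ∀ k,
        (X ^ k).submatrix (g k) (fun j : J k => (j : Fin n)) = 1 ∧
        n ≤ (J k).card + ∑ i ∈ Finset.univ.filter (fun i : Fin r => (i : ℕ) < k), q (σ i) := by
  classical
  have hcard : ∀ i, Fintype.card {j // c j = i} = q i := by
    intro i; rw [Fintype.card_subtype]; exact hfib i
  let ε := fun i => Fintype.equivFinOfCardEq (hcard i)
  let p : Fin n → ℕ := fun j => ε (c j) ⟨j, rfl⟩
  have hp : ∀ j, p j < q (c j) := fun j => (ε (c j) ⟨j, rfl⟩).2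
  have hpinj : ∀ i j, c i = c j → p i = p j → i = j := by
    have : ∀ a i j (hi : c i = a) (hj : c j = a), (ε a ⟨i, hi⟩ : ℕ) = ε a ⟨j, hj⟩ → i = j := by
      intro a i j hi hj h
      have := (ε a).injective (Fin.ext h)
      exact congrArg Subtype.val this
    intro i j hc hpp
    refine this (c j) i j hc rfl ?_
    rw [show (ε (c j) ⟨j, rfl⟩ : ℕ) = p j from rfl, ← hpp]
    have aux : ∀ a (h : c i = a), (ε a ⟨i, h⟩ : ℕ) = p i := by
      rintro a rfl; rfl
    exact aux _ hc
  have hpsurj : ∀ i m, m < q i → ∃ j, c j = i ∧ p j = m := by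
    intro i m hm
    obtain ⟨⟨j, hj⟩, h⟩ := (ε i).surjective ⟨m, hm⟩
    subst hj
    exact ⟨j, rfl, congrArg Fin.val h⟩
  let A : ℕ → Finset (Fin r) := fun m => univ.filter fun i => m < q i
  let h : Fin n → ℕ := fun j => ((A (p j)).filter (· < c j)).card
  have hlt : ∀ i j, p i = p j → c i < c j → h i < h j := by
    intro i j hpp hij
    apply card_lt_card
    rw [ssubset_iff_of_subset]
    · refine ⟨c i, ?_, by simp⟩
      simp only [A, mem_filter, mem_univ, true_and]
      exact ⟨hpp ▸ hp i, hij⟩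
    · intro x hx
      rw [hpp] at hx
      simp only [mem_filter] at hx ⊢
      exact ⟨hx.1, hx.2.trans hij⟩
  have hinj : ∀ i j, p i = p j → h i = h j → i = j := by
    intro i j hpp hh
    rcases lt_trichotomy (c i) (c j) with hl | hl | hl
    · have := hlt i j hpp hl; omega
    · exact hpinj i j hl hpp
    · have := hlt j i hpp.symm hl; omega
  have hpred : ∀ j, ∃ i, 0 < h j → p i = p j ∧ h i + 1 = h j := by
    intro j
    by_cases hj : 0 < h j
    · obtain ⟨i', hi', hlt', hc'⟩ := exists_pred (A (p j)) (c j) hj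
      obtain ⟨i, hi, hpi⟩ := hpsurj i' (p j) (by simpa [A] using hi')
      refine ⟨i, fun _ => ⟨hpi, ?_⟩⟩
      simp only [h]
      rw [hpi, hi]
      exact hc'
    · exact ⟨j, fun h => absurd h hj⟩
  choose f hf using hpred
  have hfk : ∀ k j, k ≤ h j → p (f^[k] j) = p j ∧ h (f^[k] j) + k = h j := by
    intro k
    induction k with
    | zero => intro j _; simp
    | succ k ih =>
      intro j hj
      rw [Function.iterate_succ_apply']
      have h1 := ih j (by omega)
      have h2 := hf (f^[k] j) (by omega)
      exact ⟨h2.1.trans h1.1, by omega⟩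
  let X : Matrix (Fin n) (Fin n) ℝ := fun i j => if p i = p j ∧ h i + 1 = h j then 1 else 0
  have hX : ∀ k i j, (X ^ k) i j = if p i = p j ∧ h i + k = h j then 1 else 0 := by
    intro k
    induction k with
    | zero =>
      intro i j
      rw [pow_zero, Matrix.one_apply]
      congr 1
      rw [eq_iff_iff]
      constructor
      · rintro rfl; simp
      · rintro ⟨h1, h2⟩; exact hinj i j h1 (by omega)
    | succ k ih =>
      intro i j
      rw [pow_succ, Matrix.mul_apply]
      by_cases hj : 0 < h j
      · have h1 := hf j hj
        rw [sum_eq_single (f j)]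
        · rw [ih]
          simp only [X]
          rw [if_pos h1, mul_one]
          congr 1
          rw [eq_iff_iff, h1.1]
          constructor
          · rintro ⟨a, b⟩; exact ⟨a, by omega⟩
          · rintro ⟨a, b⟩; exact ⟨a, by omega⟩
        · intro l _ hl
          simp only [X]
          rw [if_neg, mul_zero]
          rintro ⟨a, b⟩
          exact hl (hinj _ _ (a.trans h1.1.symm) (by omega))
        · simp
      · rw [if_neg (by omega)]
        apply sum_eq_zero
        intro l _
        simp only [X]
        rw [if_neg (by omega), mul_zero]
  refine ⟨X, ?_, fun k => univ.filter fun j => k ≤ h j, fun k j => f^[k] j, fun k => ⟨?_, ?_⟩⟩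
  · intro i j hij
    simp only [X]
    rw [if_neg]
    rintro ⟨a, b⟩
    rcases lt_trichotomy (c i) (c j) with hl | hl | hl
    · exact hij hl
    · have := hpinj i j hl a
      subst this; omega
    · have := hlt j i a.symm hl; omega
  · ext ⟨a, ha⟩ ⟨b, hb⟩
    simp only [mem_filter, mem_univ, true_and] at ha hb
    rw [Matrix.submatrix_apply, hX, Matrix.one_apply]
    have h1 := hfk k a ha
    congr 1
    rw [eq_iff_iff]
    simp only [Subtype.mk.injEq]
    rw [h1.1, h1.2]
    constructor
    · rintro ⟨u, v⟩; exact hinj a b u v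
    · rintro rfl; simp
  · have h1 : (univ.filter fun j => k ≤ h j).card + (univ.filter fun j => ¬ k ≤ h j).card = n := by
      rw [card_filter_add_card_filter_not]; simp
    have h2 : (univ.filter fun j => ¬ k ≤ h j).card ≤
        ∑ i ∈ univ.filter (fun i : Fin r => (i : ℕ) < k), q (σ i) := by
      have hqn : ∀ i, q i ≤ n := by
        intro i; rw [← hsum]; exact single_le_sum (fun _ _ => Nat.zero_le _) (mem_univ i)
      have h3 : ∑ i ∈ univ.filter (fun i : Fin r => (i : ℕ) < k), q (σ i) =
          ∑ m ∈ range n, (univ.filter fun i : Fin r => (i : ℕ) < k ∧ m < q (σ i)).card := by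
        have : ∀ i ∈ univ.filter (fun i : Fin r => (i : ℕ) < k),
            q (σ i) = ∑ m ∈ range n, if m < q (σ i) then 1 else 0 := by
          intro i _
          rw [← card_filter]
          rw [show (range n).filter (fun m => m < q (σ i)) = range (q (σ i)) from ?_, card_range]
          ext m
          have := hqn (σ i)
          simp only [mem_filter, mem_range]
          omega
        rw [sum_congr rfl this, sum_comm]
        apply sum_congr rfl
        intro m _
        rw [← card_filter, filter_filter]
      rw [h3, card_eq_sum_card_fiberwise (f := p) (t := range n)]
      · apply sum_le_sum
        intro m _
        refine le_trans ?_ (count_p q σ hσ k m)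
        apply card_le_card_of_injOn c
        · intro j hj
          simp only [coe_filter, mem_filter, mem_univ, true_and, Set.mem_ofPred_eq] at hj ⊢
          obtain ⟨a, rfl⟩ := hj
          refine ⟨hp j, ?_⟩
          exact not_le.1 a
        · intro i hi j hj hij
          simp only [coe_filter, mem_filter, mem_univ, true_and, Set.mem_ofPred_eq] at hi hj
          exact hpinj i j hij (hi.2.trans hj.2.symm)
      · intro j _
        simpa using (hp j).trans_le (hqn _)
    simp only
    omega

lemma conj_of_rank {n : ℕ} (A X : Matrix (Fin n) (Fin n) ℝ)
    (hr : ∀ k ≤ n, (A ^ k).rank = (X ^ k).rank) (hX : X ^ n = 0) :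
    ∃ g : GL (Fin n) ℝ, A = (g : Matrix (Fin n) (Fin n) ℝ) * X *
      (↑g⁻¹ : Matrix (Fin n) (Fin n) ℝ) := by
  have hrk : ∀ (B : Matrix (Fin n) (Fin n) ℝ) k,
      Module.finrank ℝ (LinearMap.range (Matrix.toLin' B ^ k)) = (B ^ k).rank := by
    intro B k; rw [← Matrix.toLin'_pow]; rfl
  obtain ⟨e, he, hint⟩ := intertwine (Matrix.toLin' X) (Matrix.toLin' A) n
    (by rw [← Matrix.toLin'_pow, hX, map_zero]) (by
      intro j hj
      have h1 := finrank_ker_inf (Matrix.toLin' X) j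
      have h2 := finrank_ker_inf (Matrix.toLin' A) j
      simp only [hrk] at h1 h2
      rw [hr _ (by omega), hr _ (by omega)] at h2
      omega)
  have hu : IsUnit e := (Module.End.isUnit_iff e).2
    ⟨he, LinearMap.injective_iff_surjective.1 he⟩
  have hE : IsUnit (LinearMap.toMatrix' e) :=
    hu.map (LinearMap.toMatrixAlgEquiv' : _ ≃ₐ[ℝ] Matrix (Fin n) (Fin n) ℝ)
  obtain ⟨g, hg⟩ := hE
  refine ⟨g, ?_⟩
  have hcomm : A * g = g * X := by
    rw [hg]
    apply Matrix.toLin'.injective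
    rw [Matrix.toLin'_mul, Matrix.toLin'_mul, Matrix.toLin'_toMatrix']
    exact LinearMap.ext hint
  rw [← hcomm, mul_assoc, ← Units.val_mul, mul_inv_cancel, Units.val_one, mul_one]

lemma rank_ge {n : ℕ} (A : Matrix (Fin n) (Fin n) ℝ) (J : Finset (Fin n)) (g : J → Fin n)
    (h : (A.submatrix g (fun j : J => (j : Fin n))).det ≠ 0) : J.card ≤ A.rank := by
  have h1 := Matrix.rank_of_isUnit _ ((Matrix.isUnit_iff_isUnit_det _).2 (isUnit_iff_ne_zero.2 h))
  rw [Fintype.card_coe] at h1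
  rw [← h1]
  exact Matrix.rank_submatrix_le _ _ _

lemma dense_aux {n : ℕ} (X M : Matrix (Fin n) (Fin n) ℝ)
    (J : ℕ → Finset (Fin n)) (g : ∀ k, J k → Fin n)
    (hX : ∀ k, (X ^ k).submatrix (g k) (fun j : J k => (j : Fin n)) = 1) :
    Dense {t : ℝ | ∀ k ≤ n,
      (((X + t • (M - X)) ^ k).submatrix (g k) (fun j : J k => (j : Fin n))).det ≠ 0} := by
  let P : Matrix (Fin n) (Fin n) (Polynomial ℝ) :=
    X.map Polynomial.C + (Polynomial.X : Polynomial ℝ) • (M - X).map Polynomial.C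
  let d : ℕ → Polynomial ℝ := fun k => ((P ^ k).submatrix (g k) (fun j : J k => (j : Fin n))).det
  have hP : ∀ t : ℝ, P.map (Polynomial.evalRingHom t) = X + t • (M - X) := by
    intro t
    ext i j
    simp [P]
  have hd : ∀ k t, (d k).eval t =
      (((X + t • (M - X)) ^ k).submatrix (g k) (fun j : J k => (j : Fin n))).det := by
    intro k t
    rw [← hP, ← Polynomial.coe_evalRingHom, RingHom.map_det]
    congr 1
    rw [← RingHom.mapMatrix_apply, ← map_pow]
    rfl
  let D : Polynomial ℝ := ∏ k ∈ range (n+1), d k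
  have hD : D ≠ 0 := by
    rw [prod_ne_zero_iff]
    intro k _ h0
    have := hd k 0
    rw [h0] at this
    simp [hX] at this
  have : {t : ℝ | ∀ k ≤ n,
      (((X + t • (M - X)) ^ k).submatrix (g k) (fun j : J k => (j : Fin n))).det ≠ 0}
      = {t | D.eval t = 0}ᶜ := by
    ext t
    simp only [Set.mem_ofPred_eq, Set.mem_compl_iff, D, Polynomial.eval_prod, prod_eq_zero_iff,
      mem_range, hd, not_exists, not_and, Nat.lt_succ_iff, ne_eq]
  rw [this]
  apply Set.Countable.dense_compl ℝ
  exact (Polynomial.finite_setOfPred_isRoot hD).countable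

end

/-- Proposition 4.7 for `GL(n,ℝ)`: existence of a nilpotent matrix `X` in the nilradical
`N` of the block upper triangular parabolic with blocks of sizes `q_1,…,q_r` such that
(a) `dim ker X^k` is the sum of the `k` largest values among the `q_i`, (b) the
intersection of the conjugation orbit of `X` with `N` is open and dense in `N`, and
(c) `X` is the unique such matrix up to conjugacy. -/
theorem exists_richardson_element
    {n r : ℕ} (hn : 1 ≤ n)
    (q : Fin r → ℕ) (hq : ∀ i, 0 < q i) (hsum : ∑ i, q i = n)
    -- the consecutive blocks of sizes `q_1, …, q_r` are the fibers of a monotone map `c`: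
    (c : Fin n → Fin r) (hc : Monotone c)
    (hfib : ∀ i, (Finset.univ.filter fun j => c j = i).card = q i)
    -- a rearrangement of the `q_i` into decreasing order, used to express
    -- "the sum of the `k` largest values among `q_1, …, q_r`":
    (σ : Equiv.Perm (Fin r)) (hσ : Antitone fun i => q (σ i)) :
    ∃ X ∈ {M : Matrix (Fin n) (Fin n) ℝ | ∀ i j, ¬ c i < c j → M i j = 0},
      -- (a)
      (∀ k : ℕ, k ≤ n →
        Module.finrank ℝ (LinearMap.ker (Matrix.mulVecLin (X ^ k)))
          = ∑ i ∈ Finset.univ.filter (fun i : Fin r => (i : ℕ) < k), q (σ i)) ∧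
      -- (b)
      (IsOpen {M : {M : Matrix (Fin n) (Fin n) ℝ | ∀ i j, ¬ c i < c j → M i j = 0} |
          ∃ g : GL (Fin n) ℝ,
            (M : Matrix (Fin n) (Fin n) ℝ)
              = (g : Matrix (Fin n) (Fin n) ℝ) * X * (↑g⁻¹ : Matrix (Fin n) (Fin n) ℝ)} ∧
        Dense {M : {M : Matrix (Fin n) (Fin n) ℝ | ∀ i j, ¬ c i < c j → M i j = 0} |
          ∃ g : GL (Fin n) ℝ,
            (M : Matrix (Fin n) (Fin n) ℝ)
              = (g : Matrix (Fin n) (Fin n) ℝ) * X * (↑g⁻¹ : Matrix (Fin n) (Fin n) ℝ)}) ∧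
      -- (c)
      (∀ X' ∈ {M : Matrix (Fin n) (Fin n) ℝ | ∀ i j, ¬ c i < c j → M i j = 0},
        Dense {M : {M : Matrix (Fin n) (Fin n) ℝ | ∀ i j, ¬ c i < c j → M i j = 0} |
          ∃ g : GL (Fin n) ℝ,
            (M : Matrix (Fin n) (Fin n) ℝ)
              = (g : Matrix (Fin n) (Fin n) ℝ) * X' * (↑g⁻¹ : Matrix (Fin n) (Fin n) ℝ)} →
        ∃ g : GL (Fin n) ℝ,
          X' = (g : Matrix (Fin n) (Fin n) ℝ) * X * (↑g⁻¹ : Matrix (Fin n) (Fin n) ℝ)) := by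
  classical
  obtain ⟨X, hXN, J, g, hJ⟩ := exists_X q hsum c hfib σ hσ
  have hrn : r ≤ n := by
    rw [← hsum]
    calc r = ∑ _i : Fin r, 1 := by simp
      _ ≤ _ := Finset.sum_le_sum (fun i _ => hq i)
  have hker : ∀ M : Matrix (Fin n) (Fin n) ℝ, (∀ i j, ¬ c i < c j → M i j = 0) → ∀ k,
      ∑ i ∈ Finset.univ.filter (fun i : Fin r => (i : ℕ) < k), q (σ i) ≤
      Module.finrank ℝ (LinearMap.ker (Matrix.mulVecLin (M ^ k))) := by
    intro M hM k
    have h1 := ker_lower q c hfib M hM k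
      ((Finset.univ.filter (fun i : Fin r => (i : ℕ) < k)).map σ.toEmbedding) (by
        rw [Finset.card_map]
        calc _ ≤ (Finset.range k).card := by
              apply Finset.card_le_card_of_injOn (fun i : Fin r => (i : ℕ))
              · intro i hi; simpa using hi
              · intro i _ j _ h; exact Fin.ext h
          _ = k := by simp)
    rw [Finset.sum_map] at h1
    exact h1
  have hrn' : ∀ M : Matrix (Fin n) (Fin n) ℝ, M.rank +
      Module.finrank ℝ (LinearMap.ker M.mulVecLin) = n := by
    intro M
    have := LinearMap.finrank_range_add_finrank_ker M.mulVecLin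
    rw [Module.finrank_fin_fun] at this
    exact this
  have hXrank : ∀ k, (J k).card ≤ (X ^ k).rank := by
    intro k
    apply rank_ge _ (J k) (g k)
    rw [(hJ k).1]; simp
  have hall : ∀ M : Matrix (Fin n) (Fin n) ℝ, (∀ i j, ¬ c i < c j → M i j = 0) →
      (∀ k ≤ n, (J k).card ≤ (M ^ k).rank) → ∀ k ≤ n, 
      Module.finrank ℝ (LinearMap.ker (Matrix.mulVecLin (M ^ k))) =
       ∑ i ∈ Finset.univ.filter (fun i : Fin r => (i : ℕ) < k), q (σ i) := by
    intro M hM h k hk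
    have h1 := hker M hM k
    have h2 := hrn' (M ^ k)
    have h3 := (hJ k).2
    have h4 := h k hk
    omega
  have hXn : X ^ n = 0 := by
    have h1 := hall X hXN (fun k _ => hXrank k) n le_rfl
    have h2 : Finset.univ.filter (fun i : Fin r => (i : ℕ) < n) = Finset.univ := by
      ext i; simp; omega
    rw [h2, Equiv.sum_comp σ q, hsum] at h1
    have h3 : LinearMap.ker (Matrix.mulVecLin (X ^ n)) = ⊤ :=
      Submodule.eq_top_of_finrank_eq (by rw [h1, Module.finrank_fin_fun])
    rw [LinearMap.ker_eq_top] at h3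
    exact Matrix.toLin'.injective (by rw [map_zero]; exact h3)
  have hconj : ∀ M : Matrix (Fin n) (Fin n) ℝ, (∀ i j, ¬ c i < c j → M i j = 0) →
      (∀ k ≤ n, (J k).card ≤ (M ^ k).rank) → ∃ g : GL (Fin n) ℝ,
        M = (g : Matrix (Fin n) (Fin n) ℝ) * X * (↑g⁻¹ : Matrix (Fin n) (Fin n) ℝ) := by
    intro M hM h
    apply conj_of_rank M X _ hXn
    intro k hk
    have h1 := hall M hM h k hk
    have h2 := hall X hXN (fun k _ => hXrank k) k hk
    have h3 := hrn' (M ^ k)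
    have h4 := hrn' (X ^ k)
    omega
  have hopen : IsOpen {M : {M : Matrix (Fin n) (Fin n) ℝ | ∀ i j, ¬ c i < c j → M i j = 0} |
          ∃ g : GL (Fin n) ℝ,
            (M : Matrix (Fin n) (Fin n) ℝ)
              = (g : Matrix (Fin n) (Fin n) ℝ) * X * (↑g⁻¹ : Matrix (Fin n) (Fin n) ℝ)} := by
    rw [isOpen_iff_mem_nhds]
    rintro ⟨M, hM⟩ ⟨a, ha⟩
    simp only at ha
    let φ : ℕ → {M : Matrix (Fin n) (Fin n) ℝ | ∀ i j, ¬ c i < c j → M i j = 0} → ℝ :=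
      fun k M' => ((((↑a⁻¹ : Matrix (Fin n) (Fin n) ℝ) * M' * (a : Matrix (Fin n) (Fin n) ℝ)) ^ k).submatrix
        (g k) (fun j : J k => (j : Fin n))).det
    have hφ : ∀ k, Continuous (φ k) := by
      intro k
      apply Continuous.matrix_det
      apply Continuous.matrix_submatrix
      fun_prop
    have hu : ∀ B : Matrix (Fin n) (Fin n) ℝ, ∀ k,
        ((↑a⁻¹ : Matrix (Fin n) (Fin n) ℝ) * B * (a : Matrix (Fin n) (Fin n) ℝ)) ^ k =
        (↑a⁻¹ : Matrix (Fin n) (Fin n) ℝ) * B ^ k * (a : Matrix (Fin n) (Fin n) ℝ) := by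
      intro B k
      exact Units.conj_pow' a B k
    have hev : ∀ᶠ M' in nhds (⟨M, hM⟩ : {M : Matrix (Fin n) (Fin n) ℝ | ∀ i j, ¬ c i < c j → M i j = 0}),
        ∀ k ∈ Finset.range (n+1), φ k M' ≠ 0 := by
      rw [Filter.eventually_all_finset]
      intro k _
      apply (hφ k).continuousAt.eventually_ne
      simp only [φ]
      rw [ha]
      have : (↑a⁻¹ : Matrix (Fin n) (Fin n) ℝ) * ((a : Matrix (Fin n) (Fin n) ℝ) * X * (↑a⁻¹ : Matrix (Fin n) (Fin n) ℝ)) * (a : Matrix (Fin n) (Fin n) ℝ) = X := by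
        simp only [mul_assoc, Units.inv_mul, mul_one, Units.inv_mul_cancel_left]
      rw [this, (hJ k).1]
      simp
    filter_upwards [hev] with M' hM'
    refine hconj M' M'.2 fun k hk => ?_
    have h1 := rank_ge _ (J k) (g k) (hM' k (Finset.mem_range.2 (by omega)))
    rw [hu] at h1
    refine h1.trans ?_
    exact (Matrix.rank_mul_le_left _ _).trans (Matrix.rank_mul_le_right _ _)
  have hdense : Dense {M : {M : Matrix (Fin n) (Fin n) ℝ | ∀ i j, ¬ c i < c j → M i j = 0} |
          ∃ g : GL (Fin n) ℝ,
            (M : Matrix (Fin n) (Fin n) ℝ)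
              = (g : Matrix (Fin n) (Fin n) ℝ) * X * (↑g⁻¹ : Matrix (Fin n) (Fin n) ℝ)} := by
    rintro ⟨M, hM⟩
    let ψ : ℝ → {M : Matrix (Fin n) (Fin n) ℝ | ∀ i j, ¬ c i < c j → M i j = 0} :=
      fun t => ⟨X + t • (M - X), fun i j hij => by
        simp [hXN i j hij, hM i j hij]⟩
    have hψ : Continuous ψ := by
      apply Continuous.subtype_mk
      fun_prop
    have h1 : ψ 1 = ⟨M, hM⟩ := Subtype.ext (by simp [ψ])
    rw [← h1]
    have hd := dense_aux X M J g (fun k => (hJ k).1)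
    refine map_mem_closure hψ (hd 1) ?_
    intro t ht
    exact hconj _ (ψ t).2 fun k hk => rank_ge _ (J k) (g k) (ht k hk)
  refine ⟨X, hXN, hall X hXN (fun k _ => hXrank k), ⟨hopen, hdense⟩, ?_⟩
  intro X' hX' hd
  obtain ⟨M, ⟨a, ha⟩, ⟨b, hb⟩⟩ := hd.inter_open_nonempty _ hopen
    ⟨⟨X, hXN⟩, 1, by simp⟩
  refine ⟨b⁻¹ * a, ?_⟩
  have h1 : X' = (↑b⁻¹ : Matrix (Fin n) (Fin n) ℝ) * (M : Matrix (Fin n) (Fin n) ℝ) * (b : Matrix (Fin n) (Fin n) ℝ) := by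
    rw [hb]
    simp only [mul_assoc, Units.inv_mul, mul_one, Units.inv_mul_cancel_left]
  rw [h1, ha]
  simp only [mul_inv_rev, inv_inv, Units.val_mul, mul_assoc]
end

section
/- Let (X, H, Y) be an sl₂-triple of n×n real matrices and let ν be any n×n real matrix. Then X belongs to the closure (in the matrix space with its Euclidean topology) of the set ⋃_{t > 0} {g (tν) g⁻¹ : g ∈ GL(n,ℝ)} if and only if there exists g ∈ GL(n,ℝ) such that g ν g⁻¹ ∈ X + Z(Y), i.e., g ν g⁻¹ − X commutes with Y. -/
section Alg
variable {V : Type*} [AddCommGroup V] [Module ℝ V]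

theorem slx_nilp [FiniteDimensional ℝ V] (h x : Module.End ℝ V)
    (hx : h * x - x * h = (2 : ℝ) • x) : ∃ k : ℕ, x ^ k = 0 := by
  by_contra hcon
  push Not at hcon
  have key : ∀ k : ℕ, h * x ^ k - x ^ k * h = (2 * k : ℝ) • x ^ k := by
    intro k
    induction k with
    | zero => simp
    | succ k ih =>
      have e1 : h * x ^ (k+1) - x ^ (k+1) * h
          = (h * x ^ k - x ^ k * h) * x + x ^ k * (h * x - x * h) := by
        rw [pow_succ]; noncomm_ring
      rw [e1, ih, hx, pow_succ]
      push_cast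
      simp only [smul_mul_assoc, mul_smul_comm]
      module
  let D : Module.End ℝ (Module.End ℝ V) := LinearMap.mulLeft ℝ h - LinearMap.mulRight ℝ h
  have hev : ∀ k : ℕ, D.HasEigenvalue (2 * k : ℝ) := by
    intro k
    refine Module.End.hasEigenvalue_of_hasEigenvector (x := x ^ k) ⟨?_, hcon k⟩
    rw [Module.End.mem_eigenspace_iff]
    simpa [D] using key k
  have hfin : Set.Finite (D.HasEigenvalue) := Module.End.finite_hasEigenvalue D
  have hinj : Function.Injective (fun k : ℕ => (2 * k : ℝ)) := by
    intro a b hab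
    simpa using hab
  exact Set.infinite_of_injective_forall_mem hinj hev hfin

theorem slx_comm (x h y : Module.End ℝ V)
    (hx : h * x - x * h = (2 : ℝ) • x) (hxy : x * y - y * x = h) (k : ℕ) (v : V) :
    y ((x ^ (k+1)) v) = (x ^ (k+1)) (y v) - ((k:ℝ)+1) • (x ^ k) (h v + (k:ℝ) • v) := by
  have hx' : ∀ w, h (x w) = x (h w) + (2:ℝ) • x w := by
    intro w
    have := congrArg (fun f : Module.End ℝ V => f w) hx
    simp at this
    rw [← this]; abel
  have hxy' : ∀ w, y (x w) = x (y w) - h w := by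
    intro w
    have := congrArg (fun f : Module.End ℝ V => f w) hxy
    simp at this
    rw [← this]; abel
  induction k generalizing v with
  | zero => simp [hxy']
  | succ k ih =>
    rw [pow_succ x (k+1), Module.End.mul_apply, ih (x v)]
    rw [hxy', hx', pow_succ x k]
    simp only [Module.End.mul_apply, map_sub, map_add, map_smul]
    push_cast
    module

/-- the lowest weight vectors are spanned by weight vectors of nonpositive weight -/
theorem slx_span_aux (x h y : Module.End ℝ V)
    (hx : h * x - x * h = (2 : ℝ) • x) (hy : h * y - y * h = (-2 : ℝ) • y)
    (hxy : x * y - y * x = h) (k : ℕ) (v : V) (hv : y v = 0) (hk : (x ^ k) v = 0) :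
    v ∈ Submodule.span ℝ {w | y w = 0 ∧ ∃ j : ℕ, j < k ∧ h w = (-(j:ℝ)) • w} := by
  have hy' : ∀ w, y (h w) = h (y w) + (2:ℝ) • y w := by
    intro w
    have := congrArg (fun f : Module.End ℝ V => f w) hy
    simp at this
    rw [sub_eq_iff_eq_add] at this
    rw [this]; module
  induction k generalizing v with
  | zero =>
    simp at hk
    simp [hk]
  | succ k ih =>
    have h1 := slx_comm x h y hx hxy k v
    rw [hk, hv, map_zero, map_zero, zero_sub, eq_comm, neg_eq_zero, smul_eq_zero] at h1
    have h2 : (x ^ k) (h v + (k:ℝ) • v) = 0 := h1.resolve_left (by positivity)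
    have h3 := ih (h v + (k:ℝ) • v) (by simp [hy', hv]) h2
    have h4 : ∀ z ∈ Submodule.span ℝ {w | y w = 0 ∧ ∃ j : ℕ, j < k ∧ h w = (-(j:ℝ)) • w},
        ∃ u ∈ Submodule.span ℝ {w | y w = 0 ∧ ∃ j : ℕ, j < k ∧ h w = (-(j:ℝ)) • w},
          y u = 0 ∧ h u + (k:ℝ) • u = z := by
      intro z hz
      induction hz using Submodule.span_induction with
      | mem z hz =>
        obtain ⟨hz1, j, hj, hz2⟩ := hz
        have hne : (k:ℝ) - j ≠ 0 := by
          have : (j:ℝ) < k := by exact_mod_cast hj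
          linarith
        refine ⟨((k:ℝ) - j)⁻¹ • z, Submodule.smul_mem _ _ (Submodule.subset_span ⟨hz1, j, hj, hz2⟩),
          by simp [hz1], ?_⟩
        rw [map_smul, hz2]
        have : (((k:ℝ) - j)⁻¹ * ((k:ℝ) - j)) • z = z := by rw [inv_mul_cancel₀ hne, one_smul]
        rw [← sub_eq_zero, ← sub_eq_zero.mpr this]
        module
      | zero => exact ⟨0, Submodule.zero_mem _, by simp, by simp⟩
      | add a b _ _ ha hb =>
        obtain ⟨u, hu, hu1, hu2⟩ := ha
        obtain ⟨w, hw, hw1, hw2⟩ := hb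
        refine ⟨u + w, Submodule.add_mem _ hu hw, by simp [hu1, hw1], ?_⟩
        rw [← hu2, ← hw2, map_add]; module
      | smul c a _ ha =>
        obtain ⟨u, hu, hu1, hu2⟩ := ha
        refine ⟨c • u, Submodule.smul_mem _ _ hu, by simp [hu1], ?_⟩
        rw [← hu2, map_smul]; module
    obtain ⟨u, hu, hu1, hu2⟩ := h4 _ h3
    have h5 : v = u + (v - u) := by abel
    rw [h5]
    refine Submodule.add_mem _ (Submodule.span_mono ?_ hu) (Submodule.subset_span ?_)
    · rintro w ⟨hw, j, hj, hw2⟩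
      exact ⟨hw, j, by omega, hw2⟩
    · refine ⟨by simp [hv, hu1], k, by omega, ?_⟩
      rw [map_sub, ← sub_eq_zero, ← sub_eq_zero.mpr hu2.symm]
      module

theorem slx_span [FiniteDimensional ℝ V] (x h y : Module.End ℝ V)
    (hx : h * x - x * h = (2 : ℝ) • x) (hy : h * y - y * h = (-2 : ℝ) • y)
    (hxy : x * y - y * x = h) (v : V) (hv : y v = 0) :
    v ∈ Submodule.span ℝ {w | y w = 0 ∧ ∃ j : ℕ, h w = (-(j:ℝ)) • w} := by
  obtain ⟨k, hk⟩ := slx_nilp h x hx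
  have := slx_span_aux x h y hx hy hxy k v hv (by simp [hk])
  refine Submodule.span_mono ?_ this
  rintro w ⟨hw, j, _, hw2⟩
  exact ⟨hw, j, hw2⟩

theorem slx_surj [FiniteDimensional ℝ V] (x h y : Module.End ℝ V)
    (hx : h * x - x * h = (2 : ℝ) • x) (hy : h * y - y * h = (-2 : ℝ) • y)
    (hxy : x * y - y * x = h) (a : ℝ) (ha : 0 < a) (v : V) (hv : y v = 0) :
    ∃ u, y u = 0 ∧ h u - a • u = v := by
  have h3 := slx_span x h y hx hy hxy v hv
  clear hv
  induction h3 using Submodule.span_induction with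
  | mem z hz =>
    obtain ⟨hz1, j, hz2⟩ := hz
    have hne : -(j:ℝ) - a ≠ 0 := by
      have : (0:ℝ) ≤ j := by positivity
      linarith
    refine ⟨(-(j:ℝ) - a)⁻¹ • z, by simp [hz1], ?_⟩
    rw [map_smul, hz2]
    have : ((-(j:ℝ) - a)⁻¹ * (-(j:ℝ) - a)) • z = z := by rw [inv_mul_cancel₀ hne, one_smul]
    rw [← sub_eq_zero, ← sub_eq_zero.mpr this]
    module
  | zero => exact ⟨0, by simp, by simp⟩
  | add a b _ _ ha hb =>
    obtain ⟨u, hu1, hu2⟩ := ha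
    obtain ⟨w, hw1, hw2⟩ := hb
    refine ⟨u + w, by simp [hu1, hw1], ?_⟩
    rw [← hu2, ← hw2, map_add]; module
  | smul c a _ ha =>
    obtain ⟨u, hu1, hu2⟩ := ha
    refine ⟨c • u, by simp [hu1], ?_⟩
    rw [← hu2, map_smul]; module

/-- `ker x ∩ im y = 0` -/
theorem slx_inter [FiniteDimensional ℝ V] (x h y : Module.End ℝ V)
    (hx : h * x - x * h = (2 : ℝ) • x) (hy : h * y - y * h = (-2 : ℝ) • y)
    (hxy : x * y - y * x = h) (u : V) (hu : x (y u) = 0) : y u = 0 := by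
  have hx' : ∀ w, x (h w) = h (x w) - (2:ℝ) • x w := by
    intro w
    have := congrArg (fun f : Module.End ℝ V => f w) hx
    simp at this
    rw [← this]; abel
  have hy' : ∀ w, y (h w) = h (y w) + (2:ℝ) • y w := by
    intro w
    have := congrArg (fun f : Module.End ℝ V => f w) hy
    simp at this
    rw [sub_eq_iff_eq_add] at this
    rw [this]; module
  have hny : (-h) * y - y * (-h) = (2:ℝ) • y := by
    have e : (-h) * y - y * (-h) = -(h * y - y * h) := by noncomm_ring
    rw [e, hy]; module
  have hnxy : y * x - x * y = -h := by rw [← hxy]; abel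
  obtain ⟨N, hN⟩ := slx_nilp (-h) y hny
  obtain ⟨K, hK⟩ := slx_nilp h x hx
  have main : ∀ k : ℕ, ∀ u : V, x (y u) = 0 → (y ^ k) (y u) = 0 → y u = 0 := by
    intro k
    induction k with
    | zero => intro u _ h2; simpa using h2
    | succ k ih =>
      intro u h1 h2
      have c1 := slx_comm y (-h) x hny hnxy k (y u)
      rw [h2, h1, map_zero, map_zero, zero_sub, eq_comm, neg_eq_zero, smul_eq_zero] at c1
      have c2 := c1.resolve_left (by positivity)
      have e : (-h) (y u) + (k:ℝ) • y u = y (-(h u) + ((k:ℝ)+2) • u) := by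
        rw [map_add, map_neg, hy', map_smul, LinearMap.neg_apply]; module
      rw [e] at c2
      have c3 := ih _ (by rw [← e]; simp [hx', h1]) c2
      rw [← e] at c3
      have c4 : h (y u) = (k:ℝ) • y u := by
        rw [LinearMap.neg_apply, neg_add_eq_zero] at c3
        exact c3
      obtain ⟨r, hr1, hr2⟩ := slx_surj x h y hx hy hxy ((k:ℝ)+2) (by positivity)
        (h u - ((k:ℝ)+2) • u) (by rw [map_sub, hy', map_smul, c4]; module)
      have d1 : h (u - r) = ((k:ℝ)+2) • (u - r) := by
        rw [map_sub, ← sub_eq_zero, ← sub_eq_zero.mpr hr2.symm]; module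
      have d2 : y (u - r) = y u := by simp [hr1]
      have d3 : ∀ j : ℕ, (x ^ j) (u - r) = 0 → u - r = 0 := by
        intro j
        induction j with
        | zero => intro h; simpa using h
        | succ j ihj =>
          intro hj
          apply ihj
          have c5 := slx_comm x h y hx hxy j (u - r)
          rw [hj, d2, pow_succ, Module.End.mul_apply, h1, d1, ← add_smul, map_zero, map_zero,
            zero_sub, eq_comm, neg_eq_zero, map_smul, smul_smul, smul_eq_zero] at c5
          exact c5.resolve_left (by positivity)
      rw [← d2, d3 K (by simp [hK]), map_zero]
  exact main N u hu (by simp [hN])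

/-- `im x + ker y = V` -/
theorem slx_sup [FiniteDimensional ℝ V] (x h y : Module.End ℝ V)
    (hx : h * x - x * h = (2 : ℝ) • x) (hy : h * y - y * h = (-2 : ℝ) • y)
    (hxy : x * y - y * x = h) : LinearMap.range x ⊔ LinearMap.ker y = ⊤ := by
  by_contra hne
  obtain ⟨f, hf0, hf⟩ := Submodule.exists_dual_map_eq_bot_of_lt_top (lt_top_iff_ne_top.mpr hne)
    inferInstance
  have hf' : ∀ w ∈ LinearMap.range x ⊔ LinearMap.ker y, f w = 0 := by
    intro w hw
    have : f w ∈ Submodule.map f (LinearMap.range x ⊔ LinearMap.ker y) := ⟨w, hw, rfl⟩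
    rw [hf] at this
    simpa using this
  have hfx : ∀ w, f (x w) = 0 := fun w => hf' _ (Submodule.mem_sup_left ⟨w, rfl⟩)
  have hfy : f ∈ LinearMap.range y.dualMap := by
    rw [LinearMap.range_dualMap_eq_dualAnnihilator_ker, Submodule.mem_dualAnnihilator]
    exact fun w hw => hf' _ (Submodule.mem_sup_right hw)
  obtain ⟨f', hf'⟩ := hfy
  have ap : ∀ {a b : Module.End ℝ V}, a = b → ∀ w, a w = b w := by
    intro a b hab w; rw [hab]
  have := slx_inter (V := Module.Dual ℝ V) (-x.dualMap) (-h.dualMap) (-y.dualMap)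
    (by
      ext g w
      have := congrArg g (ap hx w)
      simp at this ⊢
      linarith)
    (by
      ext g w
      have := congrArg g (ap hy w)
      simp at this ⊢
      linarith)
    (by
      ext g w
      have := congrArg g (ap hxy w)
      simp at this ⊢
      linarith) f' (by
        simp [hf']
        ext w
        simp [hfx])
  simp [hf'] at this
  exact hf0 this

end Alg

section Ana
open NormedSpace Filter Topology
variable {A : Type*} [NormedRing A] [NormedAlgebra ℝ A] [NormedAlgebra ℚ A]
  [FiniteDimensional ℝ A]

/-- the adjoint action -/
noncomputable def slAd (a : A) : Module.End ℝ A := LinearMap.mulLeft ℝ a - LinearMap.mulRight ℝ a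

theorem slAd_apply (a b : A) : slAd a b = a * b - b * a := by simp [slAd]

theorem slAd_lie (a b c : A) (h : a * b - b * a = c) :
    slAd a * slAd b - slAd b * slAd a = slAd c := by
  subst h
  ext z
  simp only [LinearMap.sub_apply, Module.End.mul_apply, slAd_apply]
  noncomm_ring

theorem slAd_smul (r : ℝ) (a : A) : slAd (r • a) = r • slAd a := by
  ext z
  simp [slAd_apply, smul_sub]

/-- exponential as a unit -/
noncomputable def slU (a : A) : Aˣ :=
  haveI := FiniteDimensional.complete ℝ A
  { val := exp a
    inv := exp (-a)
    val_inv := by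
      rw [← exp_add_of_commute (Commute.neg_right (Commute.refl a))]; simp
    inv_val := by
      rw [← exp_add_of_commute (Commute.neg_left (Commute.refl a))]; simp }

theorem slConj (H z : A) (c s : ℝ) (h : H * z - z * H = c • z) :
    exp (-(s • H)) * z * exp (s • H) = Real.exp (-(s * c)) • z := by
  haveI := FiniteDimensional.complete ℝ A
  have h1 : SemiconjBy z (s • H) (s • H + algebraMap ℝ A (-(s * c))) := by
    rw [SemiconjBy, mul_smul_comm, add_mul, smul_mul_assoc, Algebra.algebraMap_eq_smul_one,
      smul_mul_assoc, one_mul]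
    have : z * H = H * z - c • z := by rw [← h]; abel
    rw [this]; module
  have h2 := h1.exp_right
  rw [exp_add_of_commute (Algebra.commutes _ _).symm, ← algebraMap_exp_comm, ← Real.exp_eq_exp_ℝ]
    at h2
  rw [mul_assoc, h2.eq, ← mul_assoc, ← mul_assoc,
    show exp (-(s • H)) * exp (s • H) = 1 from (slU (s • H)).inv_val, one_mul,
    Algebra.algebraMap_eq_smul_one, smul_mul_assoc, one_mul]

theorem sl_tendsto (X H Y : A)
    (hHX : H * X - X * H = (2 : ℝ) • X) (hHY : H * Y - Y * H = (-2 : ℝ) • Y)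
    (hXY : X * Y - Y * X = H) (z : A) (hz : z * Y = Y * z) :
    Tendsto (fun s : ℝ => Real.exp (-(2 * s)) • (exp (-((-s) • H)) * z * exp ((-s) • H)))
      atTop (𝓝 0) := by
  have hx := slAd_lie _ _ _ hHX
  have hy := slAd_lie _ _ _ hHY
  have hxy := slAd_lie _ _ _ hXY
  rw [slAd_smul] at hx hy
  have h3 := slx_span _ _ _ hx hy hxy z (by rw [slAd_apply, hz, sub_self])
  clear hz
  induction h3 using Submodule.span_induction with
  | mem z hz =>
    obtain ⟨-, j, hj⟩ := hz
    rw [slAd_apply] at hj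
    simp_rw [slConj H z _ _ hj, smul_smul, ← Real.exp_add]
    rw [← zero_smul ℝ z]
    refine Tendsto.smul_const ?_ z
    refine Real.tendsto_exp_atBot.comp ?_
    have : (fun s : ℝ => -(2 * s) + -(-s * -(j:ℝ))) = fun s => (-(2 + j):ℝ) * s := by
      ext s; ring
    rw [this]
    refine tendsto_id.const_mul_atTop_of_neg ?_
    have : (0:ℝ) ≤ j := by positivity
    linarith
  | zero => simp
  | add a b _ _ ha hb =>
    simpa [mul_add, add_mul, smul_add] using ha.add hb
  | smul c a _ ha =>
    have := ha.const_smul c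
    rw [smul_zero] at this
    refine this.congr fun s => ?_
    rw [mul_smul_comm, smul_mul_assoc, smul_comm]

/-- rescaled slice elements are conjugate to slice elements -/
theorem sl_scale (X H Y : A)
    (hHX : H * X - X * H = (2 : ℝ) • X) (hHY : H * Y - Y * H = (-2 : ℝ) • Y)
    (z : A) (hz : z * Y = Y * z) (t : ℝ) (ht : 0 < t) :
    ∃ (g : Aˣ) (w : A), w * Y = Y * w ∧ (g : A) * (t • (X + z)) * (↑g⁻¹ : A) = X + w := by
  let s : ℝ := Real.log t / 2
  let u : Aˣ := slU (s • H)
  have e1 : (↑u⁻¹ : A) = exp (-(s • H)) := rfl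
  have e2 : (u : A) = exp (s • H) := rfl
  have cX := slConj H X 2 s hHX
  have cY := slConj H Y (-2) s hHY
  rw [← e1, ← e2] at cX cY
  have et : Real.exp (-(s * 2)) = t⁻¹ := by
    rw [show -(s * 2) = - Real.log t by simp only [s]; ring, Real.exp_neg, Real.exp_log ht]
  have et' : Real.exp (-(s * -2)) = t := by
    rw [show -(s * -2) = Real.log t by simp only [s]; ring, Real.exp_log ht]
  rw [et] at cX
  rw [et'] at cY
  refine ⟨u⁻¹, t • (↑u⁻¹ * z * ↑u), ?_, ?_⟩
  · have hY : Y = t⁻¹ • (↑u⁻¹ * Y * ↑u) := by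
      rw [cY, smul_smul, inv_mul_cancel₀ ht.ne', one_smul]
    rw [hY]
    have c1 : ∀ a b : A, (↑u⁻¹ * a * ↑u) * (↑u⁻¹ * b * ↑u) = (↑u⁻¹ * (a * b) * (u:A)) := by
      intro a b
      simp only [mul_assoc, Units.mul_inv_cancel_left]
    rw [smul_mul_smul_comm, smul_mul_smul_comm, c1, c1, hz, mul_comm t]
  · rw [inv_inv, mul_smul_comm, smul_mul_assoc, mul_add, add_mul, smul_add, cX, smul_smul,
      mul_inv_cancel₀ ht.ne', one_smul]

theorem sl_nhds (X H Y : A)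
    (hHX : H * X - X * H = (2 : ℝ) • X) (hHY : H * Y - Y * H = (-2 : ℝ) • Y)
    (hXY : X * Y - Y * X = H) :
    {M : A | ∃ (g : Aˣ) (z : A), z * Y = Y * z ∧ M = g * (X + z) * (↑g⁻¹ : A)} ∈ 𝓝 X := by
  haveI := FiniteDimensional.complete ℝ A
  have hx := slAd_lie _ _ _ hHX
  have hy := slAd_lie _ _ _ hHY
  have hxy := slAd_lie _ _ _ hXY
  rw [slAd_smul] at hx hy
  have hsup := slx_sup _ _ _ hx hy hxy
  let K : Submodule ℝ A := LinearMap.ker (slAd Y)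
  haveI : CompleteSpace K := FiniteDimensional.complete ℝ K
  let F : A × K → A := fun p => exp p.1 * (X + p.2) * exp (-p.1)
  have d1 : HasStrictFDerivAt (fun p : A × K => exp p.1) (ContinuousLinearMap.fst ℝ A K) (0, 0) :=
    (hasStrictFDerivAt_exp_zero (𝕂 := ℝ) (𝔸 := A)).comp (0, 0)
      (hasStrictFDerivAt_fst (𝕜 := ℝ) (p := ((0, 0) : A × K)))
  have d2 : HasStrictFDerivAt (fun p : A × K => exp (-p.1)) (-ContinuousLinearMap.fst ℝ A K)
      (0, 0) := by
    have h0 : HasStrictFDerivAt (exp : A → A) (1 : A →L[ℝ] A) (-((0, 0) : A × K).1) := by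
      simpa using (hasStrictFDerivAt_exp_zero (𝕂 := ℝ) (𝔸 := A))
    exact h0.comp (0, 0) (hasStrictFDerivAt_fst (𝕜 := ℝ) (p := ((0, 0) : A × K))).neg
  have d3 : HasStrictFDerivAt (fun p : A × K => X + (p.2 : A))
      (K.subtypeL.comp (ContinuousLinearMap.snd ℝ A K)) (0, 0) :=
    (K.subtypeL.comp (ContinuousLinearMap.snd ℝ A K)).hasStrictFDerivAt.const_add X
  have d4 := (d1.mul' d3).mul' d2
  have hF : F (0, 0) = X := by simp [F]
  have hm := d4.map_nhds_eq_of_surj (by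
    rw [LinearMap.range_eq_top]
    intro m
    have hm : m ∈ LinearMap.range (slAd X) ⊔ LinearMap.ker (slAd Y) := by rw [hsup]; trivial
    obtain ⟨p, ⟨a, rfl⟩, q, hq, rfl⟩ := Submodule.mem_sup.mp hm
    refine ⟨(-a, ⟨q, hq⟩), ?_⟩
    simp [slAd_apply]
    abel)
  have hm' : map F (𝓝 (0, 0)) = 𝓝 X := by rw [← hF]; exact hm
  rw [← hm', mem_map]
  refine univ_mem' fun p => ?_
  refine ⟨slU p.1, p.2, ?_, rfl⟩
  have := p.2.2
  rw [LinearMap.mem_ker, slAd_apply, sub_eq_zero] at this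
  exact this.symm

theorem sl_main (X H Y ν : A)
    (hHX : H * X - X * H = (2 : ℝ) • X)
    (hHY : H * Y - Y * H = (-2 : ℝ) • Y)
    (hXY : X * Y - Y * X = H) :
    X ∈ closure {M : A | ∃ t : ℝ, 0 < t ∧ ∃ g : Aˣ, M = (g : A) * (t • ν) * (↑g⁻¹ : A)}
      ↔ ∃ g : Aˣ, ((g : A) * ν * (↑g⁻¹ : A) - X) * Y = Y * ((g : A) * ν * (↑g⁻¹ : A) - X) := by
  constructor
  · intro hX
    obtain ⟨M, ⟨g, z, hz, hM⟩, t, ht, g', hM'⟩ :=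
      mem_closure_iff_nhds.mp hX _ (sl_nhds X H Y hHX hHY hXY)
    obtain ⟨k, w, hw, hk⟩ := sl_scale X H Y hHX hHY z hz t⁻¹ (inv_pos.mpr ht)
    refine ⟨k * g⁻¹ * g', ?_⟩
    have e : X + z = (↑g⁻¹ : A) * (g' * (t • ν) * (↑g'⁻¹ : A)) * g := by
      rw [← hM', hM]
      simp only [mul_assoc, Units.inv_mul_cancel_left, Units.inv_mul, mul_one]
    have e2 : ((k * g⁻¹ * g' : Aˣ) : A) * ν * (↑(k * g⁻¹ * g')⁻¹ : A) = X + w := by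
      rw [← hk, e]
      simp only [mul_smul_comm, smul_mul_assoc, smul_smul, inv_mul_cancel₀ ht.ne', one_smul,
        mul_inv_rev, inv_inv, Units.val_mul, mul_assoc]
    rw [e2, add_sub_cancel_left, hw]
  · rintro ⟨g, hg⟩
    set z := (g : A) * ν * (↑g⁻¹ : A) - X with hzdef
    have hgz : (g : A) * ν * (↑g⁻¹ : A) = X + z := by rw [hzdef]; abel
    have ht := (sl_tendsto X H Y hHX hHY hXY z hg).const_add X
    rw [add_zero] at ht
    refine mem_closure_of_tendsto ht (Eventually.of_forall fun s => ?_)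
    refine ⟨Real.exp (-(2 * s)), Real.exp_pos _, (slU ((-s) • H))⁻¹ * g, ?_⟩
    have e1 : (↑(slU ((-s) • H))⁻¹ : A) = exp (-((-s) • H)) := rfl
    have e2 : (↑(slU ((-s) • H)) : A) = exp ((-s) • H) := rfl
    have cX := slConj H X 2 (-s) hHX
    have e3 : (↑((slU ((-s) • H))⁻¹ * g) : A) * (Real.exp (-(2 * s)) • ν)
        * (↑((slU ((-s) • H))⁻¹ * g)⁻¹ : A)
        = Real.exp (-(2 * s)) • (exp (-((-s) • H)) * (g * ν * (↑g⁻¹ : A)) * exp ((-s) • H)) := by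
      rw [← e1, ← e2]
      simp only [mul_smul_comm, smul_mul_assoc, mul_inv_rev, inv_inv, Units.val_mul, mul_assoc]
    rw [e3, hgz, mul_add, add_mul, smul_add, cX, smul_smul, ← Real.exp_add]
    congr 1
    rw [show -(2 * s) + -(-s * 2) = 0 by ring, Real.exp_zero, one_smul]

end Ana

/-- Proposition 4.3 (Barbasch–Vogan), first statement, for `G = GL(n,ℝ)`: the nilpositive
element `X` of an `sl₂`-triple lies in the closure of `⋃_{t>0} O_{tν}` if and only if the
orbit of `ν` meets the Slodowy slice `X + Z(Y)`. -/
theorem mem_closure_cone_iff_orbit_meets_slice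
    {n : ℕ} (X H Y ν : Matrix (Fin n) (Fin n) ℝ)
    (hX0 : X ≠ 0)
    (hHX : H * X - X * H = (2 : ℝ) • X)
    (hHY : H * Y - Y * H = (-2 : ℝ) • Y)
    (hXY : X * Y - Y * X = H) :
    X ∈ closure {M : Matrix (Fin n) (Fin n) ℝ |
        ∃ t : ℝ, 0 < t ∧ ∃ g : GL (Fin n) ℝ,
          M = (g : Matrix (Fin n) (Fin n) ℝ) * (t • ν) * (↑g⁻¹ : Matrix (Fin n) (Fin n) ℝ)}
      ↔ ∃ g : GL (Fin n) ℝ,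
          ((g : Matrix (Fin n) (Fin n) ℝ) * ν * (↑g⁻¹ : Matrix (Fin n) (Fin n) ℝ) - X) * Y
            = Y * ((g : Matrix (Fin n) (Fin n) ℝ) * ν * (↑g⁻¹ : Matrix (Fin n) (Fin n) ℝ) - X) := by
  letI : NormedRing (Matrix (Fin n) (Fin n) ℝ) := Matrix.linftyOpNormedRing
  letI : NormedAlgebra ℝ (Matrix (Fin n) (Fin n) ℝ) := Matrix.linftyOpNormedAlgebra
  letI : NormedAlgebra ℚ (Matrix (Fin n) (Fin n) ℝ) := NormedAlgebra.restrictScalars ℚ ℝ _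
  exact sl_main X H Y ν hHX hHY hXY
end

section
/- Let (X, H, Y) be an sl₂-triple of n×n real matrices. If g ∈ GL(n,ℝ) satisfies g X g⁻¹ ∈ X + Z(Y), i.e., g X g⁻¹ − X commutes with Y, then g X g⁻¹ = X. Equivalently, the conjugation orbit of X meets the Slodowy slice X + Z(Y) exactly in the single point X. -/
section Sl2Aux

variable {V : Type*} [AddCommGroup V] [Module ℝ V]

lemma aux_hf (h f : Module.End ℝ V) (hf : ∀ v, h (f v) = f (h v) - (2 : ℝ) • f v)
    (k : ℕ) : ∀ v, h ((f ^ k) v) = (f ^ k) (h v) - (2 * k : ℝ) • (f ^ k) v := by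
  induction k with
  | zero => intro v; simp
  | succ k ih =>
    intro v
    rw [pow_succ', Module.End.mul_apply, hf, ih, Module.End.mul_apply]
    simp only [map_sub, map_smul]
    push_cast
    module

lemma aux_ef (e h f : Module.End ℝ V) (hf : ∀ v, h (f v) = f (h v) - (2 : ℝ) • f v)
    (ef : ∀ v, e (f v) = f (e v) + h v) (k : ℕ) :
    ∀ v, e ((f ^ (k + 1)) v) = (f ^ (k + 1)) (e v)
      + ((k : ℝ) + 1) • (f ^ k) (h v - (k : ℝ) • v) := by
  induction k with
  | zero => intro v; simp [ef]
  | succ k ih =>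
    intro v
    rw [pow_succ' f (k + 1), Module.End.mul_apply, ef, ih, Module.End.mul_apply,
      aux_hf h f hf]
    simp only [map_sub, map_smul, map_add]
    have h1 : ∀ x, f ((f ^ k) x) = (f ^ (k + 1)) x := fun x => by
      rw [pow_succ' f k, Module.End.mul_apply]
    simp only [h1]
    push_cast
    module

lemma aux_prim (e h f : Module.End ℝ V) (hf : ∀ v, h (f v) = f (h v) - (2 : ℝ) • f v)
    (ef : ∀ v, e (f v) = f (e v) + h v) (m : ℕ) (b : V) (eb : e b = 0)
    (hb : h b = (m : ℝ) • b) : ∀ j ≤ m, (f ^ j) b = 0 → b = 0 := by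
  intro j
  induction j with
  | zero => intro _ h0; simpa using h0
  | succ j ih =>
    intro hj h0
    apply ih (by omega)
    have h1 := aux_ef e h f hf ef j b
    rw [h0, eb, hb, ← sub_smul] at h1
    simp only [map_zero, map_smul, zero_add, smul_smul] at h1
    have h2 : ((j : ℝ) + 1) * ((m : ℝ) - j) ≠ 0 := by
      have : (j : ℝ) + 1 ≤ m := by exact_mod_cast hj
      apply mul_ne_zero
      · positivity
      · linarith
    exact (smul_eq_zero.mp h1.symm).resolve_left h2

lemma aux_A (e h f : Module.End ℝ V) (hf : ∀ v, h (f v) = f (h v) - (2 : ℝ) • f v)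
    (he : ∀ v, h (e v) = e (h v) + (2 : ℝ) • e v)
    (ef : ∀ v, e (f v) = f (e v) + h v) (p : ℕ) :
    ∀ (m : ℕ) (b : V), (e ^ p) b = 0 → h b = (m : ℝ) • b → (f ^ m) b = 0 → b = 0 := by
  induction p with
  | zero => intro m b h0 _ _; simpa using h0
  | succ p ih =>
    intro m b h0 hb fb
    have eb : e b = 0 := by
      apply ih (m + 2) (e b)
      · rwa [pow_succ, Module.End.mul_apply] at h0
      · rw [he, hb, map_smul]; push_cast; module
      · have h1 := aux_ef e h f hf ef (m + 1) b
        have h2 : (f ^ (m + 1)) b = 0 := by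
          rw [pow_succ', Module.End.mul_apply, fb, map_zero]
        have h3 : (f ^ (m + 1 + 1)) b = 0 := by
          rw [pow_succ', Module.End.mul_apply, h2, map_zero]
        rw [h3, hb, ← sub_smul, map_smul, h2] at h1
        simpa using h1.symm
    exact aux_prim e h f hf ef m b eb hb m le_rfl fb

lemma aux_nil [FiniteDimensional ℝ V] (e h : Module.End ℝ V) (c : ℝ) (hc : c ≠ 0)
    (he : ∀ v, h (e v) = e (h v) + c • e v) : ∃ p, e ^ p = 0 := by
  by_contra! hne
  have hk : ∀ k : ℕ, h * e ^ k - e ^ k * h = (k * c : ℝ) • e ^ k := by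
    have he' : h * e = e * h + c • e := LinearMap.ext he
    intro k
    induction k with
    | zero => simp
    | succ k ih =>
      rw [sub_eq_iff_eq_add] at ih ⊢
      rw [pow_succ, ← mul_assoc, ih, add_mul, mul_assoc (e ^ k) h e, he']
      simp only [mul_add, smul_mul_assoc, mul_smul_comm, mul_assoc]
      push_cast
      module
  let T : Module.End ℝ (Module.End ℝ V) := LinearMap.mulLeft ℝ h - LinearMap.mulRight ℝ h
  have hev : ∀ k : ℕ, T.HasEigenvalue (k * c : ℝ) := fun k =>
    Module.End.hasEigenvalue_of_hasEigenvector (x := e ^ k)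
      ⟨Module.End.mem_eigenspace_iff.mpr (by simpa [T] using hk k), hne k⟩
  have hfin : Set.Finite {μ | T.HasEigenvalue μ} := T.finite_hasEigenvalue
  exact Set.infinite_of_injective_forall_mem (f := fun k : ℕ => (k * c : ℝ))
    (fun a b hab => by simpa [hc] using hab) hev hfin

lemma aux_B [FiniteDimensional ℝ V] (e h f : Module.End ℝ V)
    (hf : ∀ v, h (f v) = f (h v) - (2 : ℝ) • f v)
    (he : ∀ v, h (e v) = e (h v) + (2 : ℝ) • e v)
    (ef : ∀ v, e (f v) = f (e v) + h v) (m : ℕ) (u : V) (hu : (f ^ m) u = 0) :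
    ∃ w, (f ^ m) w = 0 ∧ h w - (m : ℝ) • w = u := by
  obtain ⟨p, hp⟩ := aux_nil e h 2 two_ne_zero he
  let S : Module.End ℝ V := h - (m : ℝ) • (1 : Module.End ℝ V)
  have hS : ∀ v, S v = h v - (m : ℝ) • v := fun v => by simp [S]
  have hmap : ∀ v ∈ LinearMap.ker (f ^ m), S v ∈ LinearMap.ker (f ^ m) := by
    intro v hv
    rw [LinearMap.mem_ker] at hv ⊢
    have h1 := aux_hf h f hf m v
    rw [hv] at h1
    rw [hS, map_sub, map_smul, hv]
    simpa using h1.symm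
  have hinj : Function.Injective (S.restrict hmap) := by
    rw [injective_iff_map_eq_zero]
    rintro ⟨v, hv⟩ h0
    have h1 : S v = 0 := congrArg Subtype.val h0
    rw [hS, sub_eq_zero] at h1
    exact Subtype.ext (aux_A e h f hf he ef p m v (by simp [hp]) h1 hv)
  obtain ⟨⟨w, hw⟩, hwu⟩ := LinearMap.surjective_of_injective hinj ⟨u, hu⟩
  exact ⟨w, hw, by rw [← hS]; exact congrArg Subtype.val hwu⟩

lemma aux_C [FiniteDimensional ℝ V] (e h f z : Module.End ℝ V)
    (hf : ∀ v, h (f v) = f (h v) - (2 : ℝ) • f v)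
    (he : ∀ v, h (e v) = e (h v) + (2 : ℝ) • e v)
    (ef : ∀ v, e (f v) = f (e v) + h v)
    (hz : ∀ v, f (z v) = z (f v)) (j : ℕ) :
    ∀ u, (f ^ (j + 1)) u = 0 → u ∈ LinearMap.ker f ⊔ LinearMap.range (e + z) := by
  induction j with
  | zero =>
    intro u hu
    exact Submodule.mem_sup_left (by simpa using hu)
  | succ j ih =>
    intro u hu
    obtain ⟨w, hw, hwu⟩ := aux_B e h f hf he ef (j + 1 + 1) u hu
    have hzk : ∀ k : ℕ, ∀ v, (f ^ k) (z v) = z ((f ^ k) v) := by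
      intro k
      induction k with
      | zero => intro v; simp
      | succ k ih => intro v; simp only [pow_succ', Module.End.mul_apply, ih, hz]
    have hps : ∀ k : ℕ, ∀ v, (f ^ k) (f v) = (f ^ (k + 1)) v := fun k v => by
      rw [pow_succ, Module.End.mul_apply]
    have h1 := aux_ef e h f hf ef j (f w)
    rw [hps, hw, hf, map_zero] at h1
    have h2 : f (h w) - (2 : ℝ) • f w - (j : ℝ) • f w = f u := by
      rw [← hwu]; simp only [map_sub, map_smul]; push_cast; module
    rw [h2, hps] at h1
    have hj : ((j : ℝ) + 1) ≠ 0 := by positivity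
    have h3 : (f ^ (j + 1)) (u + ((j : ℝ) + 1)⁻¹ • (e + z) (f w)) = 0 := by
      rw [LinearMap.add_apply, map_add, map_smul, map_add, hzk, hps, hw, map_zero, add_zero,
        eq_neg_of_add_eq_zero_left h1.symm, smul_neg, smul_smul, inv_mul_cancel₀ hj, one_smul,
        add_neg_cancel]
    have h4 := ih _ h3
    have h5 : ((j : ℝ) + 1)⁻¹ • (e + z) (f w) ∈ LinearMap.ker f ⊔ LinearMap.range (e + z) :=
      Submodule.mem_sup_right (Submodule.smul_mem _ _ ⟨_, rfl⟩)
    exact (Submodule.add_mem_iff_left _ h5).mp h4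

lemma aux_top [FiniteDimensional ℝ V] (e h f z : Module.End ℝ V)
    (hf : ∀ v, h (f v) = f (h v) - (2 : ℝ) • f v)
    (he : ∀ v, h (e v) = e (h v) + (2 : ℝ) • e v)
    (ef : ∀ v, e (f v) = f (e v) + h v)
    (hz : ∀ v, f (z v) = z (f v)) :
    LinearMap.ker f ⊔ LinearMap.range (e + z) = ⊤ := by
  obtain ⟨p, hp⟩ := aux_nil f h (-2) (by norm_num) (fun v => by rw [hf]; module)
  rw [eq_top_iff]
  intro u _
  exact aux_C e h f z hf he ef hz p u (by rw [pow_succ, hp]; simp)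

lemma aux_rank [FiniteDimensional ℝ V] (e h f : Module.End ℝ V)
    (hf : ∀ v, h (f v) = f (h v) - (2 : ℝ) • f v)
    (he : ∀ v, h (e v) = e (h v) + (2 : ℝ) • e v)
    (ef : ∀ v, e (f v) = f (e v) + h v) :
    Module.finrank ℝ (LinearMap.range f) ≤ Module.finrank ℝ (LinearMap.range e) := by
  have h1 := aux_top e h f 0 hf he ef (by simp)
  rw [add_zero] at h1
  have h2 := Submodule.finrank_add_le_finrank_add_finrank (LinearMap.ker f) (LinearMap.range e)
  rw [h1, finrank_top] at h2
  have h3 := LinearMap.finrank_range_add_finrank_ker f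
  omega

lemma aux_disj [FiniteDimensional ℝ V] (e h f z : Module.End ℝ V)
    (hf : ∀ v, h (f v) = f (h v) - (2 : ℝ) • f v)
    (he : ∀ v, h (e v) = e (h v) + (2 : ℝ) • e v)
    (ef : ∀ v, e (f v) = f (e v) + h v)
    (hz : ∀ v, f (z v) = z (f v))
    (hr : Module.finrank ℝ (LinearMap.range (e + z)) = Module.finrank ℝ (LinearMap.range e)) :
    LinearMap.ker f ⊓ LinearMap.range (e + z) = ⊥ := by
  have h1 := aux_top e h f z hf he ef hz
  have h4 := aux_rank f (-h) e (fun v => by simp [he]; abel)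
    (fun v => by simp [hf]; abel) (fun v => by simp [ef])
  have h2 := Submodule.finrank_sup_add_finrank_inf_eq (LinearMap.ker f) (LinearMap.range (e + z))
  rw [h1, finrank_top, hr] at h2
  have h3 := LinearMap.finrank_range_add_finrank_ker f
  exact Submodule.finrank_eq_zero.mp (by omega)

end Sl2Aux

/-- Proposition 4.3 (Barbasch–Vogan), second statement, for `GL(n,ℝ)`:
the conjugation orbit of the nilpositive element `X` of an `sl₂`-triple
meets the Slodowy slice `X + Z(Y)` only in the point `X`. -/
theorem orbit_meets_slodowy_slice_in_single_point
    {n : ℕ} (X H Y : Matrix (Fin n) (Fin n) ℝ)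
    (hX0 : X ≠ 0)
    (hHX : H * X - X * H = (2 : ℝ) • X)
    (hHY : H * Y - Y * H = (-2 : ℝ) • Y)
    (hXY : X * Y - Y * X = H)
    (g : GL (Fin n) ℝ)
    (hg : ((g : Matrix (Fin n) (Fin n) ℝ) * X * (↑g⁻¹ : Matrix (Fin n) (Fin n) ℝ) - X) * Y
        = Y * ((g : Matrix (Fin n) (Fin n) ℝ) * X * (↑g⁻¹ : Matrix (Fin n) (Fin n) ℝ) - X)) :
    (g : Matrix (Fin n) (Fin n) ℝ) * X * (↑g⁻¹ : Matrix (Fin n) (Fin n) ℝ) = X := by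
  obtain ⟨G, G', hGG', hG'G⟩ := g
  change (G * X * G' - X) * Y = Y * (G * X * G' - X) at hg
  change G * X * G' = X
  let ad : Matrix (Fin n) (Fin n) ℝ → Module.End ℝ (Matrix (Fin n) (Fin n) ℝ) := fun M => LinearMap.mulLeft ℝ M - LinearMap.mulRight ℝ M
  have had : ∀ M B, ad M B = M * B - B * M := fun M B => by simp [ad]
  obtain ⟨Z, hZ⟩ : ∃ Z, Z = G * X * G' - X := ⟨_, rfl⟩
  rw [← hZ] at hg
  have hXZ : G * X * G' = X + Z := by rw [hZ]; abel
  have e1 : H * X = X * H + (2 : ℝ) • X := by rw [← hHX]; abel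
  have e2 : H * Y = Y * H + (-2 : ℝ) • Y := by rw [← hHY]; abel
  have hf : ∀ v, ad H (ad Y v) = ad Y (ad H v) - (2 : ℝ) • ad Y v := by
    intro v
    have : ad H (ad Y v) = ad Y (ad H v) + ((H * Y - Y * H) * v - v * (H * Y - Y * H)) := by
      simp only [had]; simp only [mul_sub, sub_mul, mul_add, add_mul, mul_assoc]; abel
    rw [this, hHY, had Y v, smul_mul_assoc, mul_smul_comm]; module
  have he : ∀ v, ad H (ad X v) = ad X (ad H v) + (2 : ℝ) • ad X v := by
    intro v
    have : ad H (ad X v) = ad X (ad H v) + ((H * X - X * H) * v - v * (H * X - X * H)) := by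
      simp only [had]; simp only [mul_sub, sub_mul, mul_add, add_mul, mul_assoc]; abel
    rw [this, hHX, had X v, smul_mul_assoc, mul_smul_comm]; module
  have ef : ∀ v, ad X (ad Y v) = ad Y (ad X v) + ad H v := by
    intro v
    simp only [had, ← hXY]; simp only [mul_sub, sub_mul, mul_add, add_mul, mul_assoc]; abel
  have hz : ∀ v, ad Y (ad Z v) = ad Z (ad Y v) := by
    intro v
    have : ad Y (ad Z v) = ad Z (ad Y v) + ((Y * Z - Z * Y) * v - v * (Y * Z - Z * Y)) := by
      simp only [had]; simp only [mul_sub, sub_mul, mul_add, add_mul, mul_assoc]; abel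
    rw [this, hg]; simp
  have hadd : ad X + ad Z = ad (G * X * G') := by
    ext1 v
    rw [LinearMap.add_apply, hXZ]; simp only [had]; simp only [mul_sub, sub_mul, mul_add, add_mul, mul_assoc]; abel
  -- conjugation
  have hc1 : ∀ M : Matrix (Fin n) (Fin n) ℝ, G' * (G * M) = M := fun M => by rw [← mul_assoc, hG'G, one_mul]
  have hc2 : ∀ M : Matrix (Fin n) (Fin n) ℝ, G * (G' * M) = M := fun M => by rw [← mul_assoc, hGG', one_mul]
  let c : Matrix (Fin n) (Fin n) ℝ ≃ₗ[ℝ] (Matrix (Fin n) (Fin n) ℝ) := LinearEquiv.ofLinearMap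
    (LinearMap.mulLeft ℝ G ∘ₗ LinearMap.mulRight ℝ G')
    (LinearMap.mulLeft ℝ G' ∘ₗ LinearMap.mulRight ℝ G)
    (by ext1 v; simp [mul_assoc, hc2, hGG'])
    (by ext1 v; simp [mul_assoc, hc1, hG'G])
  have hc : ∀ v, c v = G * (v * G') := fun v => rfl
  have hconj : ∀ v, ad (G * X * G') (c v) = c (ad X v) := by
    intro v
    simp only [hc, had, mul_assoc, hc1, sub_mul, mul_sub]
  have hrange : LinearMap.range (ad (G * X * G')) = (LinearMap.range (ad X)).map c.toLinearMap := by
    ext v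
    simp only [LinearMap.mem_range, Submodule.mem_map]
    constructor
    · rintro ⟨w, rfl⟩
      refine ⟨ad X (c.symm w), ⟨_, rfl⟩, ?_⟩
      change c _ = _
      rw [← hconj, c.apply_symm_apply]
    · rintro ⟨_, ⟨w, rfl⟩, rfl⟩
      exact ⟨c w, hconj w⟩
  have hr : Module.finrank ℝ (LinearMap.range (ad X + ad Z))
      = Module.finrank ℝ (LinearMap.range (ad X)) := by
    rw [hadd, hrange]
    exact LinearEquiv.finrank_map_eq c _
  have hdisj := aux_disj (ad X) (ad H) (ad Y) (ad Z) hf he ef hz hr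
  have hYZ : ad Y Z = 0 := by rw [had, hg, sub_self]
  have hW : (2 : ℝ) • Z - ad H Z ∈ LinearMap.ker (ad Y) ⊓ LinearMap.range (ad X + ad Z) := by
    constructor
    · have h1 := hf Z
      rw [hYZ] at h1
      change ad Y _ = 0
      rw [map_sub, map_smul, hYZ]
      simpa using h1.symm
    · rw [hadd]
      refine ⟨H - c H, ?_⟩
      have h3 : c (ad X H) = (-2 : ℝ) • (X + Z) := by
        rw [had, ← hXZ, ← neg_sub, hHX, hc]; simp [mul_assoc]
      rw [map_sub, hconj, h3, hXZ]
      have h4 : ad (X + Z) H = -(H * X - X * H) - ad H Z := by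
        simp only [had]; simp only [mul_sub, sub_mul, mul_add, add_mul, mul_assoc]; abel
      rw [h4, hHX]
      module
  rw [hdisj, Submodule.mem_bot, sub_eq_zero] at hW
  obtain ⟨p, hp⟩ := aux_nil (ad X) (ad H) 2 two_ne_zero he
  have hZ0 : Z = 0 := by
    apply aux_A (ad X) (ad H) (ad Y) hf he ef p 2 Z (by rw [hp]; rfl) (by rw [← hW]; norm_num)
    rw [pow_succ, Module.End.mul_apply, hYZ, map_zero]
  rw [hXZ, hZ0, add_zero]
end
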